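/- arXiv:1612.09179 — 2 statements merged into one kernel-verified Lean document; each statement's English description precedes it below -/
import Mathlib

section
/- There exists a compact connected metrizable space Y such that Y admits a minimal homeomorphism, but the Cartesian square Y × Y admits no minimal homeomorphism. -/
open Function Set Topology Filter Metric

/-- A continuous map is minimal if every forward orbit `{f^n x : n ≥ 1}` is dense. -/
def IsMinimalMap {X : Type*} [TopologicalSpace X] (f : X → X) : Prop :=
  Continuous f ∧ ∀ x : X, Dense (Set.range fun n : ℕ => f^[n + 1] x)

/-- A space admits a minimal homeomorphism. -/
def AdmitsMinimalHomeo (X : Type*) [TopologicalSpace X] : Prop :=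
  ∃ h : X ≃ₜ X, IsMinimalMap (h : X → X)

/-- Factor map between dynamical systems. -/
def IsFactorMap {X Y : Type*} [TopologicalSpace X] [TopologicalSpace Y]
    (π : X → Y) (f : X → X) (g : Y → Y) : Prop :=
  Continuous π ∧ Function.Surjective π ∧ π ∘ f = g ∘ π

/-- A map is almost 1-1 if the set of points with singleton fiber is dense. -/
def IsAlmostOneOne {X Y : Type*} [TopologicalSpace X] [TopologicalSpace Y] (π : X → Y) : Prop :=
  Dense {y : Y | ∃! x : X, π x = y}

/-- The dyadic solenoid: the inverse limit of circles under the doubling map. -/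
def dyadicSolenoid : AddSubgroup (ℕ → AddCircle (1 : ℝ)) where
  carrier := {z | ∀ k, 2 • z (k + 1) = z k}
  zero_mem' := by simp
  add_mem' := by
    intro a b ha hb k
    simp only [mem_ofPred_eq] at ha hb
    simp only [Pi.add_apply, smul_add, ha, hb]
  neg_mem' := by
    intro a ha k
    simp only [mem_ofPred_eq] at ha
    simp only [Pi.neg_apply, smul_neg, ha]

namespace dyadicSolenoid

theorem isClosed_coe : IsClosed (dyadicSolenoid : Set (ℕ → AddCircle (1 : ℝ))) := by
  have : (dyadicSolenoid : Set (ℕ → AddCircle (1 : ℝ))) =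
      ⋂ k, {z | 2 • z (k + 1) = z k} := by
    ext z
    simp [dyadicSolenoid]
  rw [this]
  exact isClosed_iInter fun k => isClosed_eq (by fun_prop) (by fun_prop)

instance : CompactSpace dyadicSolenoid :=
  isCompact_iff_compactSpace.mp isClosed_coe.isCompact

theorem two_pow_nsmul_apply (z : dyadicSolenoid) (i j : ℕ) :
    2 ^ j • z.1 (i + j) = z.1 i := by
  induction j with
  | zero => simp
  | succ j ih => rw [pow_succ, mul_smul, ← add_assoc, z.2 (i + j), ih]

/-- The one-parameter subgroup of the solenoid with speed `√2`. -/
noncomputable def leaf : ℝ →+ dyadicSolenoid where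
  toFun t := ⟨fun k => ((t * √2 / 2 ^ k : ℝ) : AddCircle (1 : ℝ)), fun k => by
    rw [← AddCircle.coe_nsmul]
    congr 1
    simp [pow_succ]
    field_simp⟩
  map_zero' := by ext k; simp
  map_add' s t := by
    ext k
    simp only [add_mul, add_div, AddCircle.coe_add]
    rfl

theorem leaf_apply (t : ℝ) (k : ℕ) :
    (leaf t).1 k = ((t * √2 / 2 ^ k : ℝ) : AddCircle (1 : ℝ)) := rfl

theorem continuous_leaf : Continuous leaf := by
  refine Continuous.subtype_mk (continuous_pi fun k => ?_) _
  exact (AddCircle.continuous_mk' 1).comp (by fun_prop)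

theorem leaf_injective : Injective leaf := by
  rw [injective_iff_map_eq_zero]
  intro t ht
  by_contra h
  obtain ⟨k, hk⟩ := pow_unbounded_of_one_lt |t * √2| (one_lt_two (α := ℝ))
  have h1 : (leaf t).1 k = 0 := by rw [ht]; rfl
  rw [leaf_apply, AddCircle.coe_eq_zero_iff] at h1
  obtain ⟨n, hn⟩ := h1
  have h3 : (0 : ℝ) < 2 ^ k := by positivity
  have h2 : t * √2 = n * 2 ^ k := by
    field_simp at hn
    simpa using hn.symm
  have hn0 : n ≠ 0 := by
    rintro rfl
    simp [h] at h2
  have h4 : (1 : ℝ) ≤ |(n : ℝ)| := by exact_mod_cast Int.one_le_abs hn0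
  rw [h2, abs_mul, abs_of_pos h3] at hk
  nlinarith

theorem dense_range_leaf_intCast : Dense (range fun n : ℤ => leaf n) := by
  rw [dense_iff_inter_open]
  rintro U hU ⟨x, hx⟩
  obtain ⟨V, hV, rfl⟩ := isOpen_induced_iff.mp hU
  obtain ⟨s, u, hu, hsub⟩ := isOpen_pi_iff.mp hV x.1 hx
  obtain ⟨K, hK⟩ := s.exists_le
  let W : Set (AddCircle (1 : ℝ)) := ⋂ i ∈ s, {w | 2 ^ (K - i) • w ∈ u i}
  have hW : IsOpen W := by
    refine isOpen_biInter_finset fun i hi => (hu i hi).1.preimage ?_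
    exact continuous_const_smul _
  have key (z : dyadicSolenoid) : z.1 K ∈ W ↔ ∀ i ∈ s, z.1 i ∈ u i := by
    simp only [W, mem_iInter, mem_ofPred_eq]
    refine forall₂_congr fun i hi => ?_
    have := two_pow_nsmul_apply z i (K - i)
    rw [Nat.add_sub_cancel' (hK i hi)] at this
    rw [this]
  have hd : DenseRange (· • ((√2 / 2 ^ K : ℝ) : AddCircle (1 : ℝ)) : ℤ → AddCircle (1 : ℝ)) := by
    rw [AddCircle.denseRange_zsmul_coe_iff]
    have := irrational_sqrt_two.div_natCast (m := 2 ^ K) (by positivity)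
    simpa using this
  obtain ⟨_, hw, n, rfl⟩ := hd.inter_open_nonempty W hW
    ⟨x.1 K, (key x).mpr fun i hi => (hu i hi).2⟩
  refine ⟨leaf n, ?_, n, rfl⟩
  refine hsub fun i hi => (key (leaf n)).mp ?_ i hi
  rw [leaf_apply]
  convert hw using 1
  simp only [← AddCircle.coe_zsmul, zsmul_eq_mul]
  congr 1
  ring

theorem exists_notMem_range_leaf : ∃ x, x ∉ range leaf := by
  have h3 (k : ℕ) : (2 : ℕ) • (((-1) ^ (k + 1) / 3 : ℝ) : AddCircle (1 : ℝ)) =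
      (((-1) ^ k / 3 : ℝ) : AddCircle (1 : ℝ)) := by
    rw [← AddCircle.coe_nsmul, ← sub_eq_zero, ← AddCircle.coe_sub, AddCircle.coe_eq_zero_iff]
    refine ⟨-(-1) ^ k, ?_⟩
    push_cast [pow_succ]
    simp
    ring
  refine ⟨⟨fun k => (((-1) ^ k / 3 : ℝ) : AddCircle (1 : ℝ)), h3⟩, ?_⟩
  rintro ⟨t, ht⟩
  have h0 : leaf (3 * t) = 0 := by
    have : leaf (3 * t) = (3 : ℕ) • leaf t := by rw [← map_nsmul]; simp
    rw [this, ht]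
    ext k
    simp only [AddSubgroup.coe_nsmul, Pi.smul_apply, ← AddCircle.coe_nsmul]
    refine AddCircle.coe_eq_zero_iff 1 |>.mpr ⟨(-1) ^ k, ?_⟩
    simp
    ring
  have ht0 : t = 0 := by
    have := leaf_injective (h0.trans (map_zero leaf).symm)
    linarith
  subst ht0
  have h1 := congrArg (fun z => z.1 0) ht
  simp only [map_zero] at h1
  have h2 := (AddCircle.coe_eq_zero_iff (1 : ℝ)).mp h1.symm
  obtain ⟨n, hn⟩ := h2
  have : (3 : ℝ) * n = 1 := by
    simp at hn
    linarith
  have : 3 * n = 1 := by exact_mod_cast this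
  omega

theorem exists_lift_path (γ : C(unitInterval, dyadicSolenoid)) (a : ℝ) (h : γ 0 = leaf a) :
    ∃ θ : C(unitInterval, ℝ), θ 0 = a ∧ ∀ t, γ t = leaf (θ t) := by
  have hs : √2 ≠ 0 := by positivity
  let γ₀ : C(unitInterval, AddCircle (1 : ℝ)) := ⟨fun t => (γ t).1 0,
    (continuous_apply 0).comp (continuous_subtype_val.comp γ.continuous)⟩
  obtain ⟨Γ, hΓ, hΓ0⟩ := (AddCircle.isCoveringMap_coe (1 : ℝ)).exists_path_lifts γ₀ (a * √2)
    (by simp [γ₀, h, leaf_apply])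
  let θ : C(unitInterval, ℝ) := ⟨fun t => Γ t / √2, by fun_prop⟩
  have hθ0 : θ 0 = a := by simp [θ, hΓ0]
  refine ⟨θ, hθ0, fun t => ?_⟩
  ext k
  let d : unitInterval → AddCircle (1 : ℝ) := fun t => (γ t).1 k - (leaf (θ t)).1 k
  have hd : Continuous d := by
    refine ((continuous_apply k).comp (continuous_subtype_val.comp γ.continuous)).sub ?_
    exact (continuous_apply k).comp
      (continuous_subtype_val.comp (continuous_leaf.comp θ.continuous))
  have hd2 (t) : 2 ^ k • d t = 0 := by
    have h1 := two_pow_nsmul_apply (γ t - leaf (θ t)) 0 k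
    rw [zero_add] at h1
    have h2 : (γ t - leaf (θ t)).1 k = d t := rfl
    rw [← h2, h1]
    have h3 := congrFun hΓ t
    simp only [comp_apply] at h3
    simp only [AddSubgroup.coe_sub, Pi.sub_apply, leaf_apply]
    simp [θ, hs, h3, γ₀]
  have hfin := AddCircle.finite_torsion (1 : ℝ) (n := 2 ^ k) (by positivity)
  have hsub : (range d).Subsingleton := by
    refine hfin.countable.isTotallyDisconnected _ ?_ (isPreconnected_range hd)
    rintro _ ⟨t, rfl⟩
    exact hd2 t
  have h4 : d t = d 0 := hsub ⟨t, rfl⟩ ⟨0, rfl⟩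
  have h5 : d 0 = 0 := by simp [d, h, hθ0]
  exact sub_eq_zero.mp (h4.trans h5)

instance : TopologicalSpace.MetrizableSpace dyadicSolenoid :=
  IsEmbedding.subtypeVal.metrizableSpace

/-- The distance to the origin for some compatible metric on the solenoid. -/
noncomputable def gauge (x : dyadicSolenoid) : ℝ :=
  letI := TopologicalSpace.metrizableSpaceMetric dyadicSolenoid
  dist x 0

theorem continuous_gauge : Continuous gauge := by
  let := TopologicalSpace.metrizableSpaceMetric dyadicSolenoid
  exact continuous_id.dist continuous_const

theorem gauge_zero : gauge 0 = 0 := by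
  let := TopologicalSpace.metrizableSpaceMetric dyadicSolenoid
  exact dist_self _

theorem gauge_pos {x : dyadicSolenoid} (hx : x ≠ 0) : 0 < gauge x := by
  let := TopologicalSpace.metrizableSpaceMetric dyadicSolenoid
  exact dist_pos.mpr hx

theorem gauge_nonneg (x : dyadicSolenoid) : 0 ≤ gauge x := by
  let := TopologicalSpace.metrizableSpaceMetric dyadicSolenoid
  exact dist_nonneg

/-- A circle-valued function on the solenoid spiralling at the origin. -/
noncomputable def phase (x : dyadicSolenoid) : AddCircle (1 : ℝ) :=
  ((gauge x)⁻¹ : ℝ)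

theorem continuousAt_phase {x : dyadicSolenoid} (hx : x ≠ 0) : ContinuousAt phase x :=
  (AddCircle.continuous_mk' 1).continuousAt.comp
    (continuous_gauge.continuousAt.inv₀ (gauge_pos hx).ne')

theorem exists_inv_eq_of_continuousOn {u : ℝ → ℝ} {a b : ℝ} (hab : a ≤ b)
    (hu : ContinuousOn u (Icc a b)) (ha : u a = 0) (hb : 0 < u b) (v : AddCircle (1 : ℝ)) :
    ∃ t ∈ Ioc a b, (((u t)⁻¹ : ℝ) : AddCircle (1 : ℝ)) = v := by
  obtain ⟨r, rfl⟩ := QuotientAddGroup.mk_surjective v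
  obtain ⟨n, hn⟩ := exists_nat_gt ((u b)⁻¹ - r)
  have hpos : 0 < (u b)⁻¹ := inv_pos.mpr hb
  have hr : (u b)⁻¹ < r + n := by linarith
  have h1 : 0 < (r + n)⁻¹ := inv_pos.mpr (hpos.trans hr)
  have h2 : (r + n)⁻¹ ≤ u b := inv_le_of_inv_le₀ hb hr.le
  obtain ⟨t, ht, htu⟩ := intermediate_value_Icc hab hu ⟨ha.le.trans h1.le, h2⟩
  refine ⟨t, ⟨lt_of_le_of_ne ht.1 ?_, ht.2⟩, ?_⟩
  · rintro rfl
    rw [ha] at htu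
    exact h1.ne htu
  · rw [htu, inv_inv]
    rw [← sub_eq_zero, ← AddCircle.coe_sub, AddCircle.coe_eq_zero_iff]
    exact ⟨n, by simp⟩

/-- The solenoid with the points `leaf n`, `n : ℤ`, blown up to circles: the `n`-th coordinate of
the second component is determined by the first component, except over `leaf n`. -/
def blowup : Set (dyadicSolenoid × (ℤ → AddCircle (1 : ℝ))) :=
  {p | ∀ n : ℤ, p.1 ≠ leaf n → p.2 n = phase (p.1 - leaf n)}

namespace blowup

theorem isClosed_blowup : IsClosed blowup := by
  have : blowup = ⋂ n : ℤ,
      ({p | p.1 ≠ leaf n} ∩ (fun p => (p.2 n, phase (p.1 - leaf n))) ⁻¹'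
        (diagonal (AddCircle (1 : ℝ)))ᶜ)ᶜ := by
    ext p
    simp [blowup]
  rw [this]
  refine isClosed_iInter fun n => isClosed_compl_iff.mpr ?_
  refine ContinuousOn.isOpen_inter_preimage ?_ (isOpen_ne_fun (by fun_prop) (by fun_prop))
    isClosed_diagonal.isOpen_compl
  intro p hp
  refine ContinuousAt.continuousWithinAt (ContinuousAt.prodMk (by fun_prop) ?_)
  have h : p.1 - leaf n ≠ 0 := sub_ne_zero.mpr hp
  exact ContinuousAt.comp (f := fun p : dyadicSolenoid × (ℤ → AddCircle (1 : ℝ)) => p.1 - leaf n)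
    (continuousAt_phase h) (by fun_prop)

instance : CompactSpace blowup :=
  isCompact_iff_compactSpace.mp isClosed_blowup.isCompact

/-- The projection of the blowup to the solenoid. -/
def proj (y : blowup) : dyadicSolenoid := y.1.1

theorem continuous_proj : Continuous proj := continuous_fst.comp continuous_subtype_val

/-- A section of the projection, continuous off the integer points of the leaf. -/
noncomputable def lift (x : dyadicSolenoid) : blowup :=
  ⟨(x, fun n => phase (x - leaf n)), fun _ _ => rfl⟩

@[simp]
theorem proj_lift (x : dyadicSolenoid) : proj (lift x) = x := rfl

theorem lift_proj {y : blowup} (h : ∀ n : ℤ, proj y ≠ leaf n) : lift (proj y) = y := by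
  refine Subtype.ext (Prod.ext rfl (funext fun n => ?_))
  exact (y.2 n (h n)).symm

theorem continuousAt_lift {x : dyadicSolenoid} (h : ∀ n : ℤ, x ≠ leaf n) :
    ContinuousAt lift x := by
  rw [ContinuousAt, tendsto_subtype_rng]
  refine Tendsto.prodMk_nhds tendsto_id (tendsto_pi_nhds.mpr fun n => ?_)
  have h' : x - leaf n ≠ 0 := sub_ne_zero.mpr (h n)
  exact ContinuousAt.comp (f := fun x : dyadicSolenoid => x - leaf n)
    (continuousAt_phase h') (by fun_prop)

/-- The lift of the translation by `leaf 1` to the blowup. -/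
noncomputable def shift : blowup ≃ₜ blowup where
  toFun y := ⟨(y.1.1 + leaf 1, fun n => y.1.2 (n - 1)), fun n hn => by
    have h : y.1.1 + leaf 1 - leaf n = y.1.1 - leaf ((n - 1 : ℤ) : ℝ) := by
      push_cast
      rw [map_sub]
      abel
    have h' := sub_ne_zero.mpr hn
    simp only [h] at h' ⊢
    exact y.2 (n - 1) (sub_ne_zero.mp h')⟩
  invFun y := ⟨(y.1.1 - leaf 1, fun n => y.1.2 (n + 1)), fun n hn => by
    have h : y.1.1 - leaf 1 - leaf n = y.1.1 - leaf ((n + 1 : ℤ) : ℝ) := by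
      push_cast
      rw [map_add]
      abel
    have h' := sub_ne_zero.mpr hn
    simp only [h] at h' ⊢
    exact y.2 (n + 1) (sub_ne_zero.mp h')⟩
  left_inv y := Subtype.ext (Prod.ext (by simp) (by simp))
  right_inv y := Subtype.ext (Prod.ext (by simp) (by simp))
  continuous_toFun := by
    refine Continuous.subtype_mk ?_ _
    fun_prop
  continuous_invFun := by
    refine Continuous.subtype_mk ?_ _
    fun_prop

theorem proj_shift_iterate (y : blowup) (k : ℕ) : proj (shift^[k] y) = proj y + leaf k := by
  induction k with
  | zero => simp
  | succ k ih =>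
    rw [iterate_succ_apply']
    change proj (shift^[k] y) + leaf 1 = _
    rw [ih]
    push_cast
    rw [map_add, add_assoc]

theorem mem_closure_lift_leaf {y : blowup} {n : ℤ} (hy : proj y = leaf n) {ε : ℝ} (hε : ε ≠ 0) :
    y ∈ closure ((fun t => lift (leaf (n + ε * t))) '' Ioo 0 1) := by
  have hex (j : ℕ) : ∃ t ∈ Ioc (0 : ℝ) (1 / (j + 2)), phase (leaf (ε * t)) = y.1.2 n := by
    have hj : (0 : ℝ) < 1 / (j + 2) := by positivity
    refine exists_inv_eq_of_continuousOn (u := fun t => gauge (leaf (ε * t))) hj.le ?_ ?_ ?_ _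
    · exact (continuous_gauge.comp (continuous_leaf.comp (by fun_prop))).continuousOn
    · simp [gauge_zero]
    · refine gauge_pos ?_
      rw [ne_eq, map_eq_zero_iff leaf leaf_injective]
      positivity
  choose t ht htv using hex
  have htlim : Tendsto t atTop (𝓝 0) := by
    refine squeeze_zero (fun j => (ht j).1.le) (fun j => (ht j).2) ?_
    exact tendsto_const_nhds.div_atTop
      (tendsto_atTop_add_const_right _ _ tendsto_natCast_atTop_atTop)
  have hleaf : Tendsto (fun j => leaf (n + ε * t j)) atTop (𝓝 (leaf n)) := by
    refine (continuous_leaf.tendsto _).comp ?_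
    simpa using (htlim.const_mul ε).const_add (n : ℝ)
  refine mem_closure_of_tendsto (f := fun j => lift (leaf (n + ε * t j))) (b := atTop) ?_
    (Eventually.of_forall fun j => mem_image_of_mem _ ⟨(ht j).1, (ht j).2.trans_lt ?_⟩)
  · rw [tendsto_subtype_rng]
    refine Tendsto.prodMk_nhds (x := proj y) (hy ▸ hleaf) (tendsto_pi_nhds.mpr fun m => ?_)
    rcases eq_or_ne m n with rfl | hmn
    · refine tendsto_const_nhds.congr fun j => ?_
      change _ = phase (leaf (m + ε * t j) - leaf m)
      rw [← map_sub, add_sub_cancel_left, htv]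
    · have h1 : proj y ≠ leaf m := by
        rw [hy]
        exact fun h => hmn (by exact_mod_cast (leaf_injective h).symm)
      rw [y.2 m h1]
      have h2 := (continuousAt_phase (sub_ne_zero.mpr h1)).tendsto
      refine h2.comp ?_
      rw [hy]
      exact hleaf.sub_const _
  · rw [div_lt_one (by positivity)]
    have : (0 : ℝ) ≤ j := by positivity
    linarith

theorem leaf_ne_intCast {n : ℤ} {t : ℝ} (ht : t ∈ Ioo (n : ℝ) (n + 1)) (m : ℤ) :
    leaf t ≠ leaf m := by
  intro h
  have := leaf_injective h
  subst this
  have h1 : n < m := by exact_mod_cast ht.1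
  have h2 : m < n + 1 := by exact_mod_cast ht.2
  omega

theorem isMinimalMap_shift : IsMinimalMap shift := by
  refine ⟨shift.continuous, fun y => ?_⟩
  set ω := closure (range fun n : ℕ => shift^[n + 1] y) with hω
  have hclosed : IsClosed ω := isClosed_closure
  have hproj : proj '' ω = univ := by
    have h1 : IsClosed (proj '' ω) := (hclosed.isCompact.image continuous_proj).isClosed
    have h2 : DenseRange fun k : ℕ => k • leaf 1 := by
      rw [← denseRange_zsmul_iff_nsmul]
      refine dense_range_leaf_intCast.mono ?_
      rintro _ ⟨n, rfl⟩
      exact ⟨n, by simp [← map_zsmul]⟩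
    have h3 : DenseRange fun k : ℕ => proj y + leaf 1 + k • leaf 1 :=
      (Homeomorph.addLeft (proj y + leaf 1)).surjective.denseRange.comp h2
        (Homeomorph.addLeft (proj y + leaf 1)).continuous
    refine eq_univ_of_univ_subset (h3.closure_eq ▸ closure_minimal ?_ h1)
    rintro _ ⟨k, rfl⟩
    refine ⟨shift^[k + 1] y, subset_closure ⟨k, rfl⟩, ?_⟩
    simp only [proj_shift_iterate, ← map_nsmul, add_assoc, ← map_add]
    congr 2
    simp [add_comm]
  have hlift {x : dyadicSolenoid} (hx : ∀ n : ℤ, x ≠ leaf n) : lift x ∈ ω := by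
    obtain ⟨y', hy', rfl⟩ := hproj.symm ▸ mem_univ x
    rwa [lift_proj hx]
  intro z
  by_cases hz : ∃ n : ℤ, proj z = leaf n
  · obtain ⟨n, hn⟩ := hz
    refine closure_minimal ?_ hclosed (mem_closure_lift_leaf hn one_ne_zero)
    rintro _ ⟨t, ht, rfl⟩
    exact hlift (leaf_ne_intCast (n := n) ⟨by linarith [ht.1], by linarith [ht.2]⟩)
  · push Not at hz
    exact lift_proj hz ▸ hlift hz

theorem proj_eq_leaf_of_joined {y y' : blowup} (h : Joined y y') {n : ℤ}
    (hy : proj y = leaf n) : proj y' = leaf n := by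
  by_contra hy'
  obtain ⟨γ⟩ := h
  let u : ℝ → ℝ := fun t => gauge (proj (γ.extend t) - leaf n)
  have hu : Continuous u :=
    continuous_gauge.comp ((continuous_proj.comp γ.continuous_extend).sub continuous_const)
  let s : ℝ → AddCircle (1 : ℝ) := fun t => (γ.extend t).1.2 n
  have hs : Continuous s := (continuous_apply n).comp
    (continuous_snd.comp (continuous_subtype_val.comp γ.continuous_extend))
  have h0 : u 0 = 0 := by simp [u, hy, gauge_zero]
  have h1 : 0 < u 1 := gauge_pos (by simpa [sub_ne_zero] using hy')
  have hus {t : ℝ} (ht : u t ≠ 0) : s t = ((u t)⁻¹ : ℝ) := by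
    refine (γ.extend t).2 n fun h => ht ?_
    change gauge ((γ.extend t).1.1 - leaf n) = 0
    rw [h, sub_self, gauge_zero]
  have hcomp : IsCompact (Icc 0 1 ∩ u ⁻¹' {0}) :=
    isCompact_Icc.inter_right (isClosed_singleton.preimage hu)
  have ha := hcomp.sSup_mem ⟨0, by simp, h0⟩
  set a := sSup (Icc 0 1 ∩ u ⁻¹' {0})
  have hua : u a = 0 := ha.2
  have hpos {t : ℝ} (ht : t ∈ Ioc a 1) : u t ≠ 0 := fun h =>
    ht.1.not_ge (le_csSup hcomp.bddAbove ⟨⟨ha.1.1.trans ht.1.le, ht.2⟩, h⟩)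
  have ha1 : a < 1 := lt_of_le_of_ne ha.1.2 fun h => by
    rw [h] at hua
    exact h1.ne' hua
  have hconst (v : AddCircle (1 : ℝ)) : s a = v := by
    by_contra hv
    have hev : ∀ᶠ t in 𝓝 a, s t ≠ v := hs.continuousAt.eventually_ne hv
    obtain ⟨δ, hδ, hball⟩ := Metric.eventually_nhds_iff.mp hev
    have hb : a < min (a + δ / 2) 1 := lt_min (by linarith) ha1
    have hub : 0 < u (min (a + δ / 2) 1) :=
      lt_of_le_of_ne' (gauge_nonneg _) (hpos ⟨hb, min_le_right _ _⟩)
    obtain ⟨t, ht, htv⟩ := exists_inv_eq_of_continuousOn hb.le hu.continuousOn hua hub v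
    refine hball (y := t) ?_ (by rw [hus (hpos ⟨ht.1, ht.2.trans (min_le_right _ _)⟩), htv])
    rw [Real.dist_eq, abs_of_pos (by linarith [ht.1])]
    linarith [ht.2, min_le_left (a + δ / 2) 1]
  have hhalf : ((1 / 2 : ℝ) : AddCircle (1 : ℝ)) = 0 := (hconst _).symm.trans (hconst 0)
  obtain ⟨m, hm⟩ := (AddCircle.coe_eq_zero_iff (1 : ℝ)).mp hhalf
  have : (2 : ℝ) * m = 1 := by
    simp at hm
    linarith
  have : 2 * m = 1 := by exact_mod_cast this
  omega

instance : TopologicalSpace.MetrizableSpace blowup :=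
  IsEmbedding.subtypeVal.metrizableSpace

/-- The part of the blowup over the closed arc of the leaf from `leaf n` to `leaf (n + 1)`. -/
def arc (n : ℤ) : Set blowup := proj ⁻¹' (leaf '' Icc (n : ℝ) (n + 1))

theorem isClosed_arc (n : ℤ) : IsClosed (arc n) :=
  (isCompact_Icc.image continuous_leaf).isClosed.preimage continuous_proj

theorem lift_leaf_mem_arc {t : ℝ} {n : ℤ} : lift (leaf t) ∈ arc n ↔ t ∈ Icc (n : ℝ) (n + 1) := by
  simp only [arc, mem_preimage, proj_lift, leaf_injective.mem_set_image]

theorem mem_arc_of_proj_eq {y : blowup} {n : ℤ} (h : proj y = leaf n) : y ∈ arc n :=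
  ⟨n, by simp, h.symm⟩

theorem mem_arc_of_proj_eq_add_one {y : blowup} {n : ℤ} (h : proj y = leaf ((n + 1 : ℤ) : ℝ)) :
    y ∈ arc n :=
  ⟨_, by simp, h.symm⟩

theorem arc_ne_univ (n : ℤ) : arc n ≠ univ := by
  intro h
  obtain ⟨x, hx⟩ := exists_notMem_range_leaf
  have : lift x ∈ arc n := h ▸ mem_univ _
  exact hx (image_subset_range _ _ this)

theorem eq_of_arc_subset_arc {m n : ℤ} (h : arc m ⊆ arc n) : m = n := by
  have h1 : lift (leaf (m + 1 / 2)) ∈ arc m := by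
    rw [lift_leaf_mem_arc]
    constructor <;> linarith
  have h2 := lift_leaf_mem_arc.mp (h h1)
  have h3 : n < m + 1 := by
    have := h2.1
    have : (n : ℝ) < m + 1 := by linarith
    exact_mod_cast this
  have h4 : m < n + 1 := by
    have := h2.2
    have : (m : ℝ) < n + 1 := by linarith
    exact_mod_cast this
  omega

theorem arc_inter_arc_nonempty {m n : ℤ} (h : (arc m ∩ arc n).Nonempty) :
    m ≤ n + 1 ∧ n ≤ m + 1 := by
  obtain ⟨y, ⟨t, ht, hty⟩, ⟨s, hs, hsy⟩⟩ := h
  obtain rfl := leaf_injective (hty.trans hsy.symm)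
  have h1 : (m : ℝ) ≤ n + 1 := ht.1.trans hs.2
  have h2 : (n : ℝ) ≤ m + 1 := hs.1.trans ht.2
  exact ⟨by exact_mod_cast h1, by exact_mod_cast h2⟩

theorem proj_eq_of_mem_arc {n : ℤ} {y : blowup} (h1 : y ∈ arc n) (h2 : y ∈ arc (n + 1)) :
    proj y = leaf ((n + 1 : ℤ) : ℝ) := by
  obtain ⟨t, ht, hty⟩ := h1
  obtain ⟨s, hs, hsy⟩ := h2
  obtain rfl := leaf_injective (hty.trans hsy.symm)
  rw [← hty, le_antisymm (by exact_mod_cast ht.2) hs.1]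

theorem pathComponent_eq_of_mem_Ioo {y : blowup} {n : ℤ} {a : ℝ} (ha : a ∈ Ioo (n : ℝ) (n + 1))
    (hy : proj y = leaf a) :
    pathComponent y = (fun t => lift (leaf t)) '' Ioo (n : ℝ) (n + 1) := by
  have hyl : lift (leaf a) = y := by
    rw [← hy]
    exact lift_proj fun m => hy ▸ leaf_ne_intCast ha m
  refine subset_antisymm ?_ (IsPathConnected.subset_pathComponent ?_ ⟨a, ha, hyl⟩)
  · rintro y' ⟨γ⟩
    have : PathConnectedSpace unitInterval := isPathConnected_iff_pathConnectedSpace.mp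
      ((convex_Icc 0 1).isPathConnected ⟨0, by simp⟩)
    have hav (t : unitInterval) (m : ℤ) : proj (γ t) ≠ leaf m := by
      intro h
      have hj : Joined (γ t) y := by
        have := (PathConnectedSpace.joined t 0).map γ.continuous
        simpa using this
      exact leaf_ne_intCast ha m (hy ▸ proj_eq_leaf_of_joined hj h)
    obtain ⟨θ, hθ0, hθ⟩ := exists_lift_path ⟨fun t => proj (γ t),
      continuous_proj.comp γ.continuous⟩ a (by simp [hy])
    simp only [ContinuousMap.coe_mk] at hθ
    have hne (t : unitInterval) (m : ℤ) : θ t ≠ m := fun h => hav t m (by rw [hθ, h])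
    refine ⟨θ 1, ⟨?_, ?_⟩, ?_⟩
    · by_contra! hle
      obtain ⟨t, ht⟩ := mem_range_of_exists_le_of_exists_ge θ.continuous ⟨1, hle⟩
        ⟨0, hθ0.symm ▸ ha.1.le⟩
      exact hne t n ht
    · by_contra! hle
      obtain ⟨t, ht⟩ := mem_range_of_exists_le_of_exists_ge θ.continuous
        ⟨0, hθ0.symm ▸ ha.2.le⟩ ⟨1, hle⟩
      exact hne t (n + 1) (by exact_mod_cast ht)
    · change lift (leaf (θ 1)) = y'
      rw [← hθ, lift_proj (hav 1), γ.target]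
  · refine ((convex_Ioo _ _).isPathConnected ⟨a, ha⟩).image' fun t ht => ?_
    exact ((continuousAt_lift (leaf_ne_intCast ht)).comp
      continuous_leaf.continuousAt).continuousWithinAt

theorem closure_pathComponent_of_mem_Ioo {y : blowup} {n : ℤ} {a : ℝ}
    (ha : a ∈ Ioo (n : ℝ) (n + 1)) (hy : proj y = leaf a) :
    closure (pathComponent y) = arc n := by
  rw [pathComponent_eq_of_mem_Ioo ha hy]
  refine subset_antisymm (closure_minimal ?_ (isClosed_arc n)) ?_
  · rintro _ ⟨t, ht, rfl⟩
    exact lift_leaf_mem_arc.mpr (Ioo_subset_Icc_self ht)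
  · rintro z ⟨t, ht, htz⟩
    rcases ht.1.eq_or_lt with rfl | h1
    · refine closure_mono ?_ (mem_closure_lift_leaf htz.symm one_ne_zero)
      rintro _ ⟨t, ht, rfl⟩
      exact ⟨n + 1 * t, ⟨by linarith [ht.1], by linarith [ht.2]⟩, rfl⟩
    · rcases ht.2.eq_or_lt with rfl | h2
      · refine closure_mono ?_ (mem_closure_lift_leaf (n := n + 1) (ε := -1)
          (by simpa using htz.symm) (by norm_num))
        rintro _ ⟨t, ht, rfl⟩
        refine ⟨n + 1 + -1 * t, ⟨by linarith [ht.2], by linarith [ht.1]⟩, by simp⟩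
      · refine subset_closure ⟨t, ⟨h1, h2⟩, ?_⟩
        change lift (leaf t) = z
        rw [htz]
        exact lift_proj fun m => htz ▸ leaf_ne_intCast ⟨h1, h2⟩ m

theorem closure_pathComponent_of_notMem_range {y : blowup} (hy : proj y ∉ range leaf) :
    closure (pathComponent y) = univ := by
  have hne (t : ℝ) (n : ℤ) : proj y + leaf t ≠ leaf n := by
    intro h
    exact hy ⟨n - t, by rw [map_sub, ← h, add_sub_cancel_right]⟩
  have hpc : IsPathConnected (range fun t : ℝ => lift (proj y + leaf t)) := by
    refine isPathConnected_range (continuous_iff_continuousAt.mpr fun t => ?_)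
    exact (continuousAt_lift (hne t)).comp (f := fun t : ℝ => proj y + leaf t)
      (continuous_const.add continuous_leaf).continuousAt
  have hy0 : y ∈ range fun t : ℝ => lift (proj y + leaf t) :=
    ⟨0, by simpa using lift_proj fun n => by simpa using hne 0 n⟩
  refine ((isMinimalMap_shift.2 y).mono ?_).closure_eq
  rintro _ ⟨k, rfl⟩
  refine hpc.subset_pathComponent hy0 ⟨(k + 1 : ℕ), ?_⟩
  have h := proj_shift_iterate y (k + 1)
  change lift (proj y + leaf ((k + 1 : ℕ) : ℝ)) = _
  rw [← h]
  exact lift_proj fun n => h ▸ hne _ n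

theorem closure_pathComponent_subset {y : blowup} {n : ℤ} (hy : proj y = leaf n) :
    closure (pathComponent y) ⊆ arc n ∩ arc (n - 1) := by
  refine closure_minimal (fun y' h => ?_) ((isClosed_arc n).inter (isClosed_arc (n - 1)))
  have h' := proj_eq_leaf_of_joined h hy
  exact ⟨mem_arc_of_proj_eq h', mem_arc_of_proj_eq_add_one (by simpa using h')⟩

theorem closure_pathComponent_cases (y : blowup) :
    (∃ n, closure (pathComponent y) ⊂ arc n) ∨ (∃ n, closure (pathComponent y) = arc n) ∨
      closure (pathComponent y) = univ := by
  by_cases hy : proj y ∈ range leaf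
  · obtain ⟨t, ht⟩ := hy
    by_cases hm : ∃ n : ℤ, t = n
    · obtain ⟨n, rfl⟩ := hm
      refine Or.inl ⟨n, ?_⟩
      have h := closure_pathComponent_subset ht.symm
      refine ⟨h.trans inter_subset_left, fun h' => ?_⟩
      have := eq_of_arc_subset_arc (h'.trans (h.trans inter_subset_right))
      omega
    · push Not at hm
      refine Or.inr (Or.inl ⟨⌊t⌋, closure_pathComponent_of_mem_Ioo
        ⟨(Int.floor_le t).lt_of_ne (hm _).symm, Int.lt_floor_add_one t⟩ ht.symm⟩)
  · exact Or.inr (Or.inr (closure_pathComponent_of_notMem_range hy))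

theorem exists_closure_pathComponent_eq_arc (n : ℤ) :
    ∃ y : blowup, closure (pathComponent y) = arc n :=
  ⟨lift (leaf (n + 1 / 2)),
    closure_pathComponent_of_mem_Ioo ⟨by linarith, by linarith⟩ (proj_lift _)⟩

theorem exists_closure_pathComponent_eq_univ : ∃ y : blowup, closure (pathComponent y) = univ :=
  exists_notMem_range_leaf.imp' lift fun _ hx => closure_pathComponent_of_notMem_range hx

theorem closure_pathComponent_eq_of_arc_subset {y : blowup} {n : ℤ}
    (h : arc n ⊆ closure (pathComponent y)) :
    closure (pathComponent y) = arc n ∨ closure (pathComponent y) = univ := by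
  rcases closure_pathComponent_cases y with ⟨m, hm⟩ | ⟨m, hm⟩ | hu
  · obtain rfl := eq_of_arc_subset_arc (h.trans hm.1)
    exact absurd h hm.2
  · rw [hm] at h
    exact Or.inl (eq_of_arc_subset_arc h ▸ hm)
  · exact Or.inr hu

instance : ConnectedSpace blowup := by
  obtain ⟨y, hy⟩ := exists_closure_pathComponent_eq_univ
  rw [connectedSpace_iff_univ, ← hy]
  exact isPathConnected_pathComponent.isConnected.closure

theorem arc_inter_arc_nonempty_iff {m n : ℤ} :
    (arc m ∩ arc n).Nonempty ↔ m ≤ n + 1 ∧ n ≤ m + 1 := by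
  refine ⟨arc_inter_arc_nonempty, fun ⟨h1, h2⟩ => ⟨lift (leaf ((max m n : ℤ) : ℝ)), ?_, ?_⟩⟩ <;>
  · rw [lift_leaf_mem_arc]
    constructor
    · exact_mod_cast (by omega)
    · exact_mod_cast (by omega)

theorem arc_nonempty (n : ℤ) : (arc n).Nonempty :=
  (arc_inter_arc_nonempty_iff.mpr ⟨by omega, by omega⟩ : (arc n ∩ arc n).Nonempty).mono
    inter_subset_left

theorem dense_integer_fibers : Dense {y : blowup | ∃ m : ℤ, proj y = leaf m} := by
  refine (isMinimalMap_shift.2 (lift 0)).mono ?_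
  rintro _ ⟨k, rfl⟩
  exact ⟨(k + 1 : ℕ), by rw [proj_shift_iterate]; simp⟩

/-- The coordinates of a point of the square, indexed by `Bool`. -/
def coord (b : Bool) (z : blowup × blowup) : blowup := cond b z.1 z.2

theorem continuous_coord (b : Bool) : Continuous (coord b) := by
  cases b
  exacts [continuous_snd, continuous_fst]

theorem isOpenMap_coord (b : Bool) : IsOpenMap (coord b) := by
  cases b
  exacts [isOpenMap_snd, isOpenMap_fst]

/-- The points of the square with a given coordinate in a given arc. -/
def slab (b : Bool) (n : ℤ) : Set (blowup × blowup) := coord b ⁻¹' arc n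

theorem slab_true (n : ℤ) : slab true n = arc n ×ˢ univ := by
  ext z
  simp [slab, coord]

theorem slab_false (n : ℤ) : slab false n = univ ×ˢ arc n := by
  ext z
  simp [slab, coord]

theorem slab_inter_slab_nonempty_iff {b b' : Bool} {m n : ℤ} :
    (slab b m ∩ slab b' n).Nonempty ↔ (b = b' → m ≤ n + 1 ∧ n ≤ m + 1) := by
  cases b <;> cases b' <;>
  simp only [slab_true, slab_false, prod_inter_prod, prod_nonempty_iff, univ_inter, inter_univ,
    univ_nonempty, true_and, and_true, arc_inter_arc_nonempty_iff, forall_const, arc_nonempty,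
    reduceCtorEq, IsEmpty.forall_iff]

end blowup

end dyadicSolenoid

/-- `S` is maximal among the proper subsets that are closures of path components. -/
def IsMaximalComponentClosure {Z : Type*} [TopologicalSpace Z] (S : Set Z) : Prop :=
  S ≠ univ ∧ (∃ z, closure (pathComponent z) = S) ∧
    ∀ w, S ⊆ closure (pathComponent w) →
      closure (pathComponent w) = S ∨ closure (pathComponent w) = univ

theorem Homeomorph.image_closure_pathComponent {Z W : Type*} [TopologicalSpace Z]
    [TopologicalSpace W] (h : Z ≃ₜ W) (z : Z) :
    h '' closure (pathComponent z) = closure (pathComponent (h z)) := by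
  rw [h.image_closure]
  congr 1
  ext w
  constructor
  · rintro ⟨x, hx, rfl⟩
    exact Joined.map hx h.continuous
  · intro hw
    refine ⟨h.symm w, ?_, h.apply_symm_apply w⟩
    have := Joined.map hw h.symm.continuous
    rwa [h.symm_apply_apply] at this

theorem IsMaximalComponentClosure.image {Z W : Type*} [TopologicalSpace Z]
    [TopologicalSpace W] {S : Set Z} (hS : IsMaximalComponentClosure S) (h : Z ≃ₜ W) :
    IsMaximalComponentClosure (h '' S) := by
  obtain ⟨hne, ⟨z, rfl⟩, hmax⟩ := hS
  refine ⟨fun hu => hne ?_, ⟨h z, (h.image_closure_pathComponent z).symm⟩, fun w hw => ?_⟩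
  · rwa [← image_univ_of_surjective h.surjective, h.injective.image_injective.eq_iff] at hu
  · obtain ⟨w, rfl⟩ := h.surjective w
    rw [← h.image_closure_pathComponent] at hw ⊢
    rw [h.injective.image_injective.eq_iff]
    refine (hmax w ((image_subset_image_iff h.injective).mp hw)).imp_right fun hu => ?_
    rw [hu, image_univ_of_surjective h.surjective]

theorem closure_pathComponent_prod {Z W : Type*} [TopologicalSpace Z] [TopologicalSpace W]
    (x : Z × W) :
    closure (pathComponent x) = closure (pathComponent x.1) ×ˢ closure (pathComponent x.2) := by
  rw [← closure_prod_eq, ← pathComponent_prod]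

theorem exists_eq_mul_add_of_near_iff {f : ℤ → ℤ}
    (hf : ∀ m n, (f m ≤ f n + 1 ∧ f n ≤ f m + 1) ↔ (m ≤ n + 1 ∧ n ≤ m + 1)) :
    ∃ s c : ℤ, (s = 1 ∨ s = -1) ∧ ∀ n, f n = s * n + c := by
  have hstep (n : ℤ) : (f (n + 1) - f n = 1 ∨ f (n + 1) - f n = -1) ∧
      f (n + 1 + 1) - f (n + 1) = f (n + 1) - f n := by
    have h1 := hf n (n + 1)
    have h2 := hf (n + 1) (n + 1 + 1)
    have h3 := hf n (n + 1 + 1)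
    omega
  have hconst (n : ℤ) : f (n + 1) - f n = f 1 - f 0 := by
    induction n with
    | zero => simp
    | succ n ih => exact (hstep n).2.trans ih
    | pred n ih =>
      have := (hstep (-n - 1)).2
      rw [sub_add_cancel] at this ⊢
      exact this.symm.trans ih
  refine ⟨f 1 - f 0, f 0, by simpa using (hstep 0).1, fun n => ?_⟩
  induction n with
  | zero => simp
  | succ n ih => linear_combination hconst n + ih
  | pred n ih =>
    have := hconst (-n - 1)
    rw [sub_add_cancel] at this
    linear_combination ih - this

theorem exists_affine_of_near_iff {τ : Bool → ℤ → Bool} {σ : Bool → ℤ → ℤ}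
    (H : ∀ b m b' n, (τ b m = τ b' n → σ b m ≤ σ b' n + 1 ∧ σ b' n ≤ σ b m + 1) ↔
      (b = b' → m ≤ n + 1 ∧ n ≤ m + 1)) :
    ∃ (β : Bool → Bool) (s c : Bool → ℤ), Injective β ∧ (∀ b, s b = 1 ∨ s b = -1) ∧
      ∀ b n, τ b n = β b ∧ σ b n = s b * n + c b := by
  have hfar {b : Bool} {m n : ℤ} (h : m + 1 < n) : τ b m = τ b n := by
    by_contra hne
    have := (H b m b n).mp (fun h => absurd h hne) rfl
    omega
  have hτ (b : Bool) (n : ℤ) : τ b n = τ b 0 := by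
    rw [hfar (n := max n 0 + 2) (by omega), ← hfar (m := 0) (n := max n 0 + 2) (by omega)]
  have hσ (b : Bool) := exists_eq_mul_add_of_near_iff (f := σ b) fun m n => by
    simpa [hτ b m, hτ b n] using H b m b n
  choose s c hs hσ using hσ
  refine ⟨fun b => τ b 0, s, c, fun b b' hb => ?_, hs, fun b n => ⟨hτ b n, hσ b n⟩⟩
  by_contra hne
  have key (m n : ℤ) : σ b m ≤ σ b' n + 1 ∧ σ b' n ≤ σ b m + 1 :=
    (H b m b' n).mpr (fun h => absurd h hne) ((hτ b m).trans (hb.trans (hτ b' n).symm))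
  have h0 := key 0 0
  have h4 := key 4 0
  rw [hσ b] at h0 h4
  rcases hs b with h | h <;> rw [h] at h0 h4 <;> omega

theorem IsMinimalMap.finite_range {Z W : Type*} [TopologicalSpace Z] [TopologicalSpace W]
    [T1Space W] [Nonempty Z] {f : Z → Z} (hf : IsMinimalMap f) {φ : Z → W} (hφ : Continuous φ)
    {p : ℕ} (hp : 0 < p) (h : ∀ z, φ (f^[p] z) = φ z) : (range φ).Finite := by
  obtain ⟨z⟩ := ‹Nonempty Z›
  have hper : Periodic (fun k => φ (f^[k] z)) p := fun k => by
    simp only [add_comm k p, iterate_add_apply, h]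
  have hfin : ((fun k => φ (f^[k] z)) '' Iio p).Finite := (finite_Iio p).image _
  refine hfin.subset ?_
  have hd := hφ.range_subset_closure_image_dense (hf.2 z)
  refine hd.trans (closure_minimal ?_ hfin.isClosed)
  rintro _ ⟨_, ⟨k, rfl⟩, rfl⟩
  exact ⟨(k + 1) % p, Nat.mod_lt _ hp, hper.map_mod_nat (k + 1)⟩

namespace dyadicSolenoid

namespace blowup

theorem isMaximalComponentClosure_iff {S : Set (blowup × blowup)} :
    IsMaximalComponentClosure S ↔ ∃ b n, S = slab b n := by
  obtain ⟨u, hu⟩ := exists_closure_pathComponent_eq_univ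
  have hslab (b : Bool) (n : ℤ) :
      slab b n ≠ univ ∧ ∃ z, closure (pathComponent z) = slab b n := by
    obtain ⟨y, hy⟩ := exists_closure_pathComponent_eq_arc n
    cases b
    · refine ⟨?_, (u, y), by rw [closure_pathComponent_prod, hu, hy, slab_false]⟩
      rw [slab_false, ne_eq, univ_prod, preimage_eq_univ_iff, range_eq_univ.mpr Prod.snd_surjective]
      exact fun h => arc_ne_univ n (eq_univ_of_univ_subset h)
    · refine ⟨?_, (y, u), by rw [closure_pathComponent_prod, hu, hy, slab_true]⟩
      rw [slab_true, ne_eq, prod_univ, preimage_eq_univ_iff, range_eq_univ.mpr Prod.fst_surjective]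
      exact fun h => arc_ne_univ n (eq_univ_of_univ_subset h)
  constructor
  · rintro ⟨hne, ⟨z, rfl⟩, hmax⟩
    have hsub {b : Bool} {n : ℤ} (h : closure (pathComponent z) ⊆ slab b n) :
        closure (pathComponent z) = slab b n := by
      obtain ⟨hn, w, hw⟩ := hslab b n
      rw [← hw] at h hn ⊢
      exact ((hmax w h).resolve_right hn).symm
    have hcases (y : blowup) : (∃ n, closure (pathComponent y) ⊆ arc n) ∨
        closure (pathComponent y) = univ := by
      rcases closure_pathComponent_cases y with ⟨n, h⟩ | ⟨n, h⟩ | h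
      exacts [Or.inl ⟨n, h.1⟩, Or.inl ⟨n, h.subset⟩, Or.inr h]
    rcases hcases z.1 with ⟨n, h1⟩ | h1
    · refine ⟨true, n, hsub ?_⟩
      rw [closure_pathComponent_prod, slab_true]
      exact prod_mono h1 (subset_univ _)
    rcases hcases z.2 with ⟨n, h2⟩ | h2
    · refine ⟨false, n, hsub ?_⟩
      rw [closure_pathComponent_prod, slab_false]
      exact prod_mono (subset_univ _) h2
    · exact absurd (by rw [closure_pathComponent_prod, h1, h2, univ_prod_univ]) hne
  · rintro ⟨b, n, rfl⟩
    refine ⟨(hslab b n).1, (hslab b n).2, fun w hw => ?_⟩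
    rw [closure_pathComponent_prod] at hw ⊢
    cases b
    · rw [slab_false] at hw ⊢
      rcases prod_subset_prod_iff.mp hw with ⟨h1, h2⟩ | h | h
      · rw [univ_subset_iff] at h1
        rw [h1]
        refine (closure_pathComponent_eq_of_arc_subset h2).imp (fun h => by rw [h])
          fun h => by rw [h, univ_prod_univ]
      · exact absurd h univ_nonempty.ne_empty
      · exact absurd h (arc_nonempty n).ne_empty
    · rw [slab_true] at hw ⊢
      rcases prod_subset_prod_iff.mp hw with ⟨h1, h2⟩ | h | h
      · rw [univ_subset_iff] at h2
        rw [h2]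
        refine (closure_pathComponent_eq_of_arc_subset h1).imp (fun h => by rw [h])
          fun h => by rw [h, univ_prod_univ]
      · exact absurd h (arc_nonempty n).ne_empty
      · exact absurd h univ_nonempty.ne_empty

/-- Every homeomorphism of the square covers a signed permutation of the coordinates followed by a
translation by integer points of the leaf. -/
theorem exists_affine_factor (h : blowup × blowup ≃ₜ blowup × blowup) :
    ∃ (β : Bool → Bool) (s c : Bool → ℤ), Injective β ∧ (∀ b, s b = 1 ∨ s b = -1) ∧
      ∀ b z, proj (coord (β b) (h z)) = s b • proj (coord b z) + leaf (c b) := by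
  have hex (b : Bool) (n : ℤ) : ∃ b' n', h '' slab b n = slab b' n' :=
    isMaximalComponentClosure_iff.mp
      ((isMaximalComponentClosure_iff.mpr ⟨b, n, rfl⟩).image h)
  choose τ σ hτσ using hex
  obtain ⟨β, s, c, hβ, hs, hτσ'⟩ := exists_affine_of_near_iff (τ := τ) (σ := σ) fun b m b' n => by
    rw [← slab_inter_slab_nonempty_iff, ← slab_inter_slab_nonempty_iff, ← hτσ, ← hτσ,
      ← image_inter h.injective, image_nonempty]
  have hmem {b : Bool} {n : ℤ} {z : blowup × blowup} (hz : coord b z ∈ arc n) :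
      coord (β b) (h z) ∈ arc (s b * n + c b) := by
    have : h z ∈ slab (τ b n) (σ b n) := hτσ b n ▸ mem_image_of_mem h hz
    rwa [(hτσ' b n).1, (hτσ' b n).2] at this
  have hb (b : Bool) : ∃ c' : ℤ, ∀ z,
      proj (coord (β b) (h z)) = s b • proj (coord b z) + leaf c' := by
    have hclosed (c' : ℤ) :
        IsClosed {z | proj (coord (β b) (h z)) = s b • proj (coord b z) + leaf c'} := by
      have h1 := continuous_proj.comp ((continuous_coord (β b)).comp h.continuous)
      have h2 := continuous_proj.comp (continuous_coord b)
      exact isClosed_eq h1 ((h2.zsmul (s b)).add continuous_const)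
    have hdense : Dense (coord b ⁻¹' {y | ∃ m : ℤ, proj y = leaf m}) :=
      dense_integer_fibers.preimage (isOpenMap_coord b)
    suffices ∃ c' : ℤ, ∀ (m : ℤ) z, proj (coord b z) = leaf m →
        proj (coord (β b) (h z)) = leaf ((s b * m + c' : ℤ) : ℝ) by
      obtain ⟨c', hc'⟩ := this
      refine ⟨c', fun z => closure_minimal ?_ (hclosed c') (hdense z)⟩
      rintro z ⟨m, hm⟩
      simp only [mem_ofPred_eq, hc' m z hm, hm, ← map_zsmul, ← map_add]
      simp
    have hadj (m : ℤ) (z) (hz : proj (coord b z) = leaf m) :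
        coord (β b) (h z) ∈ arc (s b * m + c b) ∧
          coord (β b) (h z) ∈ arc (s b * (m - 1) + c b) :=
      ⟨hmem (mem_arc_of_proj_eq hz), hmem (mem_arc_of_proj_eq_add_one (by simpa using hz))⟩
    rcases hs b with hsb | hsb <;> rw [hsb] at hadj ⊢
    · refine ⟨c b, fun m z hz => ?_⟩
      obtain ⟨h1, h2⟩ := hadj m z hz
      have := proj_eq_of_mem_arc h2 (by convert h1 using 2; ring)
      rw [this]
      congr 2
      ring
    · refine ⟨c b + 1, fun m z hz => ?_⟩
      obtain ⟨h1, h2⟩ := hadj m z hz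
      have := proj_eq_of_mem_arc h1 (by convert h2 using 2; ring)
      rw [this]
      congr 2
      ring
  choose c' hc' using hb
  exact ⟨β, s, c', hβ, hs, hc'⟩

theorem exists_translation_factor (h : blowup × blowup ≃ₜ blowup × blowup) :
    ∃ a : Bool → ℤ, ∀ b z, proj (coord b (h^[4] z)) = proj (coord b z) + leaf (a b) := by
  obtain ⟨β, s, c, hβ, hs, H⟩ := exists_affine_factor h
  have hββ (b : Bool) : β (β b) = b := hβ (Bool.apply_apply_apply β b)
  have H2 (b : Bool) (z) : proj (coord b (h (h z))) =
      (s (β b) * s b) • proj (coord b z) + leaf ((s (β b) * c b + c (β b) : ℤ) : ℝ) := by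
    have := H (β b) (h z)
    rw [hββ] at this
    rw [this, H b z, smul_add, mul_smul, add_assoc, ← map_zsmul, ← map_add]
    simp
  refine ⟨fun b => s (β b) * s b * (s (β b) * c b + c (β b)) + (s (β b) * c b + c (β b)),
    fun b z => ?_⟩
  have hsq : s (β b) * s b * (s (β b) * s b) = 1 := by
    rcases hs b with h1 | h1 <;> rcases hs (β b) with h2 | h2 <;> simp [h1, h2]
  change proj (coord b (h (h (h (h z))))) = _
  rw [H2, H2, smul_add, ← mul_smul, hsq, one_smul, add_assoc, ← map_zsmul, ← map_add]
  congr 2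
  push_cast [zsmul_eq_mul]
  ring

theorem not_admitsMinimalHomeo_prod : ¬ AdmitsMinimalHomeo (blowup × blowup) := by
  rintro ⟨h, hmin⟩
  obtain ⟨a, ha⟩ := exists_translation_factor h
  have hcont (b : Bool) : Continuous fun z => proj (coord b z) :=
    continuous_proj.comp (continuous_coord b)
  have hinf {φ : blowup × blowup → dyadicSolenoid} (n : ℤ) (hn : n ≠ 0) (b : Bool)
      (hφ : ∀ t, φ (cond b (lift (leaf t), lift 0) (lift 0, lift (leaf t))) = n • leaf t) :
      (range φ).Infinite := by
    refine infinite_of_injective_forall_mem (f := fun t : ℝ => leaf (n * t)) ?_ fun t =>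
      ⟨_, (hφ t).trans (by rw [← map_zsmul, zsmul_eq_mul])⟩
    exact leaf_injective.comp (mul_right_injective₀ (by exact_mod_cast hn))
  have : Nonempty (blowup × blowup) := ⟨(lift 0, lift 0)⟩
  by_cases h0 : a true = 0
  · refine hinf (φ := fun z => proj (coord true z)) 1 one_ne_zero true (fun t => ?_)
      (hmin.finite_range (hcont true) (p := 4) (by norm_num) fun z => ?_)
    · simp [coord]
    · rw [ha, h0]
      simp
  · refine hinf (φ := fun z => a true • proj (coord false z) - a false • proj (coord true z))
      (a true) h0 false (fun t => ?_)
      (hmin.finite_range (((hcont false).zsmul _).sub ((hcont true).zsmul _)) (p := 4)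
        (by norm_num) fun z => ?_)
    · simp [coord]
    · simp only [ha, smul_add, ← map_zsmul leaf, zsmul_eq_mul, mul_comm (a true : ℝ)]
      abel

end blowup

end dyadicSolenoid

/-- There exists a compact connected metrizable space `Y` that admits a minimal
homeomorphism while its square `Y × Y` admits no minimal homeomorphism. -/
theorem stmt0 :
    ∃ (Y : Type) (_ : TopologicalSpace Y),
      CompactSpace Y ∧ ConnectedSpace Y ∧ TopologicalSpace.MetrizableSpace Y ∧
      AdmitsMinimalHomeo Y ∧ ¬ AdmitsMinimalHomeo (Y × Y) :=
  ⟨dyadicSolenoid.blowup, inferInstance, inferInstance, inferInstance, inferInstance,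
    ⟨dyadicSolenoid.blowup.shift, dyadicSolenoid.blowup.isMinimalMap_shift⟩,
    dyadicSolenoid.blowup.not_admitsMinimalHomeo_prod⟩
end

section
/- There exists a compact connected metrizable space Y admitting a minimal homeomorphism such that for every integer n ≥ 2 the Cartesian power Y^n (the product of n copies of Y) admits no minimal homeomorphism. -/
open Function Set Topology Filter Metric

/-- The dyadic solenoid: the inverse limit of circles under the doubling map. -/
def solenoid : AddSubgroup (ℕ → UnitAddCircle) where
  carrier := {x | ∀ n, x (n + 1) + x (n + 1) = x n}
  zero_mem' := by simp
  add_mem' := by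
    intro x y hx hy n
    rw [Pi.add_apply, Pi.add_apply, ← hx n, ← hy n]
    abel
  neg_mem' := by
    intro x hx n
    rw [Pi.neg_apply, Pi.neg_apply, ← hx n]
    abel

namespace Solenoid

lemma isClosed_coe : IsClosed (solenoid : Set (ℕ → UnitAddCircle)) := by
  have : (solenoid : Set (ℕ → UnitAddCircle)) = ⋂ n, {x | x (n + 1) + x (n + 1) = x n} := by
    ext x
    simp [solenoid]
  rw [this]
  exact isClosed_iInter fun n => isClosed_eq (by fun_prop) (by fun_prop)

instance : CompactSpace solenoid := isCompact_iff_compactSpace.mp isClosed_coe.isCompact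

instance : TopologicalSpace.MetrizableSpace solenoid := IsEmbedding.subtypeVal.metrizableSpace

lemma double_apply (x : solenoid) (n : ℕ) : x.1 (n + 1) + x.1 (n + 1) = x.1 n := x.2 n

lemma apply_eq_pow_nsmul (x : solenoid) (n k : ℕ) : x.1 n = 2 ^ k • x.1 (n + k) := by
  induction k with
  | zero => simp
  | succ k ih =>
    rw [ih, ← double_apply x (n + k), pow_succ, mul_nsmul, two_nsmul, nsmul_add, ← add_assoc]

/-- The one-parameter subgroup `s ↦ (√2 s / 2 ^ n)ₙ` of the solenoid. -/
noncomputable def line : ℝ →+ solenoid where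
  toFun s := ⟨fun n => ((√2 * s / 2 ^ n : ℝ) : UnitAddCircle), fun n => by
    rw [← AddCircle.coe_add]
    congr 1
    rw [pow_succ]
    ring⟩
  map_zero' := by ext n; simp
  map_add' s t := by
    ext n
    simp only [AddSubgroup.coe_add, Pi.add_apply, ← AddCircle.coe_add]
    congr 1
    ring

lemma line_apply (s : ℝ) (n : ℕ) :
    (line s).1 n = ((√2 * s / 2 ^ n : ℝ) : UnitAddCircle) := rfl

lemma continuous_line : Continuous line := by
  refine Continuous.subtype_mk (continuous_pi fun n => ?_) _
  exact (AddCircle.continuous_mk' 1).comp (by fun_prop)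

lemma line_injective : Injective line := by
  refine (injective_iff_map_eq_zero line).mpr fun s hs => ?_
  by_contra hne
  have hpos : 0 < |√2 * s| := by positivity
  obtain ⟨n, hn⟩ := pow_unbounded_of_one_lt |√2 * s| (one_lt_two)
  have h0 : ((√2 * s / 2 ^ n : ℝ) : UnitAddCircle) = 0 := by
    rw [← line_apply, hs]
    rfl
  obtain ⟨m, hm⟩ := AddCircle.coe_eq_zero_iff (1 : ℝ) |>.mp h0
  have habs : |(m : ℝ)| < 1 := by
    rw [zsmul_eq_mul, mul_one] at hm
    rw [hm, abs_div, abs_of_pos (by positivity : (0 : ℝ) < 2 ^ n), div_lt_one (by positivity)]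
    exact hn
  have hm0 : m = 0 := by
    rw [← Int.cast_abs] at habs
    exact Int.abs_lt_one_iff.mp (by exact_mod_cast habs)
  rw [hm0, zero_smul, eq_comm, div_eq_zero_iff] at hm
  rcases hm with hm | hm
  · rw [hm, abs_zero] at hpos
    exact lt_irrefl _ hpos
  · exact absurd hm (by positivity)

lemma exists_norm_line_sub_lt (x : solenoid) (N : ℕ) {ε : ℝ} (hε : 0 < ε) :
    ∃ j : ℕ, ‖(line (j + 1)).1 N - x.1 N‖ < ε := by
  have hirr : Irrational (√2 / 2 ^ N / 1 : ℝ) := by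
    have := irrational_sqrt_two.div_natCast (m := 2 ^ N) (by positivity)
    simpa using this
  have hd := denseRange_zsmul_iff_nsmul.mp (AddCircle.denseRange_zsmul_coe_iff.mpr hirr)
  obtain ⟨j, hj⟩ := hd.exists_dist_lt (x.1 N - ((√2 / 2 ^ N : ℝ) : UnitAddCircle)) hε
  refine ⟨j, ?_⟩
  rw [dist_eq_norm, norm_sub_rev] at hj
  have h : (line (j + 1)).1 N - x.1 N
      = j • ((√2 / 2 ^ N : ℝ) : UnitAddCircle) - (x.1 N - ((√2 / 2 ^ N : ℝ) : UnitAddCircle)) := by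
    rw [line_apply, ← AddCircle.coe_nsmul, ← sub_add, sub_add_eq_add_sub, ← AddCircle.coe_add]
    congr 2
    rw [nsmul_eq_mul]
    ring
  rw [h]
  exact hj

lemma mem_closure_range_add_line (x z : solenoid) :
    z ∈ closure (range fun j : ℕ => x + line (j + 1)) := by
  choose j hj using fun N : ℕ =>
    exists_norm_line_sub_lt (z - x) N (by positivity : (0 : ℝ) < (1 / 4) ^ N)
  refine mem_closure_of_tendsto (f := fun N => x + line (j N + 1)) (b := atTop) ?_
    (Eventually.of_forall fun N => mem_range_self _)
  rw [tendsto_subtype_rng, tendsto_pi_nhds]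
  intro n
  rw [tendsto_iff_norm_sub_tendsto_zero]
  have hlim : Tendsto (fun N : ℕ => (2 : ℝ) ^ N * (1 / 4) ^ N) atTop (𝓝 0) := by
    simp_rw [← mul_pow]
    exact tendsto_pow_atTop_nhds_zero_of_lt_one (by norm_num) (by norm_num)
  refine squeeze_zero' (Eventually.of_forall fun N => norm_nonneg _) ?_ hlim
  filter_upwards [eventually_ge_atTop n] with N hN
  obtain ⟨k, rfl⟩ := Nat.exists_eq_add_of_le hN
  have h1 : (x + line (j (n + k) + 1)).1 n - z.1 n
      = 2 ^ k • ((line (j (n + k) + 1)).1 (n + k) - (z - x).1 (n + k)) := by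
    rw [nsmul_sub, ← apply_eq_pow_nsmul, ← apply_eq_pow_nsmul]
    simp only [AddSubgroup.coe_add, AddSubgroup.coe_sub, Pi.add_apply, Pi.sub_apply]
    abel
  rw [h1]
  refine (norm_nsmul_le).trans ?_
  push_cast
  refine mul_le_mul ?_ (hj _).le (norm_nonneg _) (by positivity)
  exact pow_le_pow_right₀ one_le_two (by omega)

lemma exists_notMem_range_line : ∃ q : solenoid, q ∉ range line := by
  let q : solenoid := ⟨fun n => (((4 ^ n - 1) / 3 / 2 ^ n : ℝ) : UnitAddCircle), fun n => by
    rw [← AddCircle.coe_add, ← sub_eq_zero, ← AddCircle.coe_sub, AddCircle.coe_eq_zero_iff]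
    refine ⟨2 ^ n, ?_⟩
    have : (4 : ℝ) ^ n = 2 ^ n * 2 ^ n := by rw [← mul_pow]; norm_num
    simp only [pow_succ, this]
    field_simp
    ring⟩
  refine ⟨q, ?_⟩
  rintro ⟨s, hs⟩
  have h2 : √2 ≠ 0 := by positivity
  have h3 : line (3 * s) = line (-(1 / √2)) := by
    have h : line (3 * s) = q + q + q := by
      rw [← hs, ← map_add, ← map_add]
      congr 1
      ring
    rw [h]
    ext n
    change (((4 ^ n - 1) / 3 / 2 ^ n : ℝ) : UnitAddCircle)
      + (((4 ^ n - 1) / 3 / 2 ^ n : ℝ) : UnitAddCircle)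
      + (((4 ^ n - 1) / 3 / 2 ^ n : ℝ) : UnitAddCircle) = _
    rw [line_apply, ← AddCircle.coe_add, ← AddCircle.coe_add, ← sub_eq_zero, ← AddCircle.coe_sub,
      AddCircle.coe_eq_zero_iff]
    refine ⟨2 ^ n, ?_⟩
    have : (4 : ℝ) ^ n = 2 ^ n * 2 ^ n := by rw [← mul_pow]; norm_num
    simp only [this]
    field_simp
    ring
  have h4 : √2 * s = -(1 / 3) := by
    have := line_injective h3
    field_simp at this ⊢
    linarith
  have h5 : ((-(1 / 3) : ℝ) : UnitAddCircle) = 0 := by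
    have h := congrArg (fun x : solenoid => x.1 0) hs
    simp only [line_apply, h4] at h
    simpa [q] using h
  obtain ⟨m, hm⟩ := AddCircle.coe_eq_zero_iff (1 : ℝ) |>.mp h5
  rw [zsmul_eq_mul, mul_one] at hm
  have h6 : (3 * m : ℝ) = -1 := by rw [hm]; norm_num
  have h7 : 3 * m = -1 := by exact_mod_cast h6
  omega

lemma exists_lift_path (γ : C(unitInterval, solenoid)) :
    ∃ σ : C(unitInterval, ℝ), σ 0 = 0 ∧ ∀ τ, γ τ = γ 0 + line (σ τ) := by
  have cov := AddCircle.isCoveringMap_coe (1 : ℝ)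
  let c (n : ℕ) : C(unitInterval, UnitAddCircle) := ⟨fun τ => (γ τ).1 n - (γ 0).1 n,
    ((continuous_apply n).comp (continuous_subtype_val.comp γ.continuous)).sub continuous_const⟩
  have hc (n : ℕ) : c n 0 = ((0 : ℝ) : UnitAddCircle) := by simp [c]
  let l (n : ℕ) : C(unitInterval, ℝ) := cov.liftPath (c n) 0 (hc n)
  have hl (n : ℕ) (τ : unitInterval) : ((l n τ : ℝ) : UnitAddCircle) = c n τ :=
    congrFun (cov.liftPath_lifts (c n) 0 (hc n)) τ
  have hl0 (n : ℕ) : l n 0 = 0 := cov.liftPath_zero (c n) 0 (hc n)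
  have hstep (n : ℕ) : l (n + 1) + l (n + 1) = l n := by
    refine (cov.eq_liftPath_iff' (hc n)).mpr ⟨?_, ?_⟩
    · funext τ
      simp only [comp_apply, ContinuousMap.add_apply, AddCircle.coe_add, hl]
      simp only [c, ContinuousMap.coe_mk]
      rw [← double_apply (γ τ) n, ← double_apply (γ 0) n]
      abel
    · simp [hl0]
  have hpow (n : ℕ) (τ : unitInterval) : l n τ = l 0 τ / 2 ^ n := by
    induction n with
    | zero => simp
    | succ n ih =>
      have h := congrArg (fun g : C(unitInterval, ℝ) => g τ) (hstep n)
      simp only [ContinuousMap.add_apply] at h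
      rw [pow_succ, ← div_div, ← ih]
      linarith
  refine ⟨⟨fun τ => l 0 τ / √2, by fun_prop⟩, by simp [hl0], fun τ => ?_⟩
  ext n
  simp only [AddSubgroup.coe_add, Pi.add_apply, line_apply, ContinuousMap.coe_mk]
  rw [mul_div_cancel₀ _ (by positivity : √2 ≠ 0), ← hpow, hl]
  simp [c]

end Solenoid

/-- A function on the complement of `ℓ 0` vanishing along the curve `ℓ` shortly before time `0`
and oscillating like the topologist's sine curve immediately after it. -/
lemma exists_oscillating {M : Type*} [TopologicalSpace M] [TopologicalSpace.MetrizableSpace M]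
    {ℓ : ℝ → M} (hc : Continuous ℓ) (hi : Injective ℓ) :
    ∃ f : M → ℝ, (∀ x, x ≠ ℓ 0 → ContinuousAt f x) ∧ (∀ x, f x ∈ Icc (-1 : ℝ) 1) ∧
      (∀ s ∈ Icc (-1 : ℝ) 0, f (ℓ s) = 0) ∧
      ∀ v ∈ Icc (-1 : ℝ) 1, ∀ ε > 0, ∃ s ∈ Ioo 0 ε, f (ℓ s) = v := by
  let _ := TopologicalSpace.metrizableSpaceMetric M
  let P : Set M := ℓ '' Icc (-1) 0
  let Q : Set M := ℓ '' Icc 0 1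
  have hP : IsClosed P := (isCompact_Icc.image hc).isClosed
  have hQ : IsClosed Q := (isCompact_Icc.image hc).isClosed
  have hP0 : ℓ 0 ∈ P := mem_image_of_mem _ (by norm_num)
  have hQ0 : ℓ 0 ∈ Q := mem_image_of_mem _ (by norm_num)
  have hPQ : ∀ x, infDist x P + infDist x Q = 0 → x = ℓ 0 := by
    intro x hx
    have h1 : infDist x P = 0 := by
      linarith [infDist_nonneg (x := x) (s := P), infDist_nonneg (x := x) (s := Q)]
    have h2 : infDist x Q = 0 := by linarith
    obtain ⟨s, hs, rfl⟩ := (hP.mem_iff_infDist_zero ⟨_, hP0⟩).mpr h1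
    obtain ⟨r, hr, hrs⟩ := (hQ.mem_iff_infDist_zero ⟨_, hQ0⟩).mpr h2
    rw [hi hrs] at hr
    rw [le_antisymm hs.2 hr.1]
  let ψ : M → ℝ := fun x => infDist x P / (infDist x P + infDist x Q)
  have hψ : ∀ x, ψ x ∈ Icc (0 : ℝ) 1 := fun x => by
    have h1 := infDist_nonneg (x := x) (s := P)
    have h2 := infDist_nonneg (x := x) (s := Q)
    exact ⟨by positivity, div_le_one_of_le₀ (by linarith) (by positivity)⟩
  refine ⟨fun x => ψ x * Real.sin (1 / dist x (ℓ 0)), fun x hx => ?_, fun x => ?_, ?_, ?_⟩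
  · have h1 : infDist x P + infDist x Q ≠ 0 := fun h => hx (hPQ x h)
    have h2 : dist x (ℓ 0) ≠ 0 := dist_ne_zero.mpr hx
    refine ContinuousAt.mul ?_ (Real.continuous_sin.continuousAt.comp ?_)
    · exact (continuous_infDist_pt P).continuousAt.div
        ((continuous_infDist_pt P).add (continuous_infDist_pt Q)).continuousAt h1
    · exact continuousAt_const.div (by fun_prop) h2
  · rw [mem_Icc, ← abs_le, abs_mul, abs_of_nonneg (hψ x).1]
    exact mul_le_one₀ (hψ x).2 (abs_nonneg _) (Real.abs_sin_le_one _)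
  · intro s hs
    have : infDist (ℓ s) P = 0 := infDist_zero_of_mem (mem_image_of_mem _ hs)
    simp [ψ, this]
  · intro v hv ε hε
    let δ := min ε 1 / 2
    have hδ : 0 < δ := by positivity
    have hδε : δ < ε := by
      have := min_le_left ε 1
      simp only [δ]
      linarith
    have hδ1 : δ ≤ 1 := by
      have := min_le_right ε 1
      simp only [δ]
      linarith
    have hg : 0 < dist (ℓ δ) (ℓ 0) := dist_pos.mpr fun h => hδ.ne' (hi h)
    obtain ⟨k, hk⟩ := exists_nat_gt (1 / dist (ℓ δ) (ℓ 0) + 2)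
    let θ := Real.arcsin v + k * (2 * Real.pi)
    have hθ : 1 / dist (ℓ δ) (ℓ 0) < θ := by
      have h1 := Real.neg_pi_div_two_le_arcsin v
      have h2 := Real.pi_gt_three
      have h3 := Real.pi_lt_four
      have h4 : (k : ℝ) ≤ k * (2 * Real.pi) := by nlinarith [(Nat.cast_nonneg k : (0 : ℝ) ≤ k)]
      simp only [θ]
      linarith
    have hθ0 : 0 < θ := lt_trans (by positivity) hθ
    have hmem : 1 / θ ∈ Icc (dist (ℓ 0) (ℓ 0)) (dist (ℓ δ) (ℓ 0)) := by
      rw [dist_self]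
      exact ⟨by positivity, ((one_div_lt hθ0 hg).mpr hθ).le⟩
    obtain ⟨s, hs, hsθ⟩ := intermediate_value_Icc (f := fun s => dist (ℓ s) (ℓ 0)) hδ.le
      (by fun_prop) hmem
    simp only at hsθ
    have hs0 : 0 < s := by
      refine lt_of_le_of_ne hs.1 ?_
      rintro rfl
      rw [dist_self] at hsθ
      exact (one_div_pos.mpr hθ0).ne hsθ
    refine ⟨s, ⟨hs0, hs.2.trans_lt hδε⟩, ?_⟩
    have hQs : infDist (ℓ s) Q = 0 :=
      infDist_zero_of_mem (mem_image_of_mem _ ⟨hs0.le, hs.2.trans hδ1⟩)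
    have hPs : infDist (ℓ s) P ≠ 0 := by
      intro h
      exact hs0.ne' (hi (hPQ _ (by rw [h, hQs, add_zero])))
    simp only [ψ]
    rw [hQs, add_zero, div_self hPs, one_mul, hsθ, one_div_one_div, Real.sin_add_nat_mul_two_pi,
      Real.sin_arcsin hv.1 hv.2]

/-- The path component of `q` meets the closure of the path component of `p`. -/
def Reaches {X : Type*} [TopologicalSpace X] (p q : X) : Prop :=
  (closure (pathComponent p) ∩ pathComponent q).Nonempty

section Topology

variable {X Y : Type*} [TopologicalSpace X] [TopologicalSpace Y]

lemma Homeomorph.image_pathComponent (h : X ≃ₜ Y) (p : X) :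
    h '' pathComponent p = pathComponent (h p) := by
  ext y
  constructor
  · rintro ⟨x, hx, rfl⟩
    exact Joined.map hx h.continuous
  · intro hy
    refine ⟨h.symm y, ?_, h.apply_symm_apply y⟩
    have := Joined.map hy h.symm.continuous
    rwa [h.symm_apply_apply] at this

lemma Homeomorph.reaches_iff (h : X ≃ₜ Y) {p q : X} : Reaches (h p) (h q) ↔ Reaches p q := by
  rw [Reaches, Reaches, ← h.image_pathComponent, ← h.image_pathComponent, ← h.image_closure,
    ← image_inter h.injective, image_nonempty]

/-- Only finitely many path components meet the closure of the path component of `p`. -/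
def FinitelyReaching {X : Type*} [TopologicalSpace X] (p : X) : Prop :=
  ∃ F : Set X, F.Finite ∧ ∀ q, Reaches p q → ∃ z ∈ F, Joined z q

lemma FinitelyReaching.map {p : X} (hp : FinitelyReaching p) (h : X ≃ₜ Y) :
    FinitelyReaching (h p) := by
  obtain ⟨F, hF, hpF⟩ := hp
  refine ⟨h '' F, hF.image h, fun q hq => ?_⟩
  obtain ⟨z, hz, hzq⟩ := hpF (h.symm q) (by rwa [← h.reaches_iff, h.apply_symm_apply])
  refine ⟨h z, mem_image_of_mem h hz, ?_⟩
  simpa using hzq.map h.continuous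

variable {ι : Type*}

lemma joined_pi_iff {p q : ι → X} : Joined p q ↔ ∀ i, Joined (p i) (q i) :=
  ⟨fun h i => h.map (continuous_apply i), Joined.pi⟩

lemma reaches_pi_iff {p q : ι → X} : Reaches p q ↔ ∀ i, Reaches (p i) (q i) := by
  rw [Reaches, pathComponent_pi, pathComponent_pi, closure_pi_set, ← pi_inter_distrib,
    univ_pi_nonempty_iff]
  rfl

end Topology

section IntegerLattice

variable {ι : Type*}

/-- Each coordinate of `v` equals the one of `u` or is smaller by one. -/
def CubeStep (u v : ι → ℤ) : Prop := ∀ i, v i = u i ∨ v i = u i - 1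

lemma covBy_iff_exists_add_single [DecidableEq ι] {u v : ι → ℤ} :
    u ⋖ v ↔ ∃ i, v = u + Pi.single i 1 := by
  rw [Pi.covBy_iff]
  refine exists_congr fun i => ⟨fun ⟨h1, h2⟩ => ?_, ?_⟩
  · funext j
    rcases eq_or_ne j i with rfl | hj
    · simpa using (Order.covBy_iff_add_one_eq.mp h1).symm
    · simp [hj, h2 j hj]
  · rintro rfl
    exact ⟨by simp, fun j hj => by simp [hj]⟩

variable [Fintype ι]

lemma reflTransGen_cubeStep_iff {u v : ι → ℤ} : Relation.ReflTransGen CubeStep u v ↔ v ≤ u := by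
  constructor
  · intro h
    induction h with
    | refl => exact le_rfl
    | tail _ hbc ih =>
      intro i
      rcases hbc i with h2 | h2
      · exact h2.trans_le (ih i)
      · exact h2.trans_le ((sub_le_self _ zero_le_one).trans (ih i))
  · intro h
    have hchain : ∀ m : ℕ, Relation.ReflTransGen CubeStep u (fun i => max (v i) (u i - m)) := by
      intro m
      induction m with
      | zero =>
        convert Relation.ReflTransGen.refl using 2 with i
        simp [h i]
      | succ m ih =>
        refine ih.tail fun i => ?_
        push_cast
        omega
    convert hchain (∑ i, (u i - v i).toNat) using 2 with i
    have h1 : (u i - v i).toNat ≤ ∑ i, (u i - v i).toNat :=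
      Finset.single_le_sum (f := fun i => (u i - v i).toNat) (fun _ _ => Nat.zero_le _)
        (Finset.mem_univ i)
    omega

variable [DecidableEq ι]

lemma eq_apply_zero_of_forall_add_single {α : Type*} {F : (ι → ℤ) → α}
    (h : ∀ u i, F (u + Pi.single i 1) = F u) (u : ι → ℤ) : F u = F 0 := by
  let P : AddSubgroup (ι → ℤ) :=
    { carrier := {w | ∀ u, F (u + w) = F u}
      zero_mem' := by simp
      add_mem' := by
        intro a b ha hb u
        rw [← add_assoc, hb, ha]
      neg_mem' := by
        intro a ha u
        rw [← ha, neg_add_cancel_right] }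
  have hu : u ∈ P := by
    rw [← Finset.univ_sum_single u]
    refine P.sum_mem fun i _ => ?_
    have h1 : (Pi.single i 1 : ι → ℤ) ∈ P := fun u => h u i
    have h2 := P.zsmul_mem h1 (u i)
    rwa [← Pi.single_smul, smul_eq_mul, mul_one] at h2
  simpa using hu 0

lemma OrderIso.exists_perm_of_int_pi (θ : (ι → ℤ) ≃o (ι → ℤ)) :
    ∃ σ : Equiv.Perm ι, ∀ u, θ u = θ 0 + u ∘ σ := by
  have hex (u : ι → ℤ) (i : ι) : ∃ j, θ (u + Pi.single i 1) = θ u + Pi.single j 1 :=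
    covBy_iff_exists_add_single.mp
      ((apply_covBy_apply_iff θ).mpr (covBy_iff_exists_add_single.mpr ⟨i, rfl⟩))
  choose s hs using hex
  have hsingle {i j : ι} (h : (Pi.single i 1 : ι → ℤ) = Pi.single j 1) : i = j := by
    by_contra hij
    have := congrFun h i
    simp [hij] at this
  have hinj (u : ι → ℤ) : Injective (s u) := by
    intro i j hij
    refine hsingle (add_left_cancel (a := u) (θ.injective ?_))
    rw [hs, hs, hij]
  have hoff (u : ι → ℤ) {i j : ι} (hij : j ≠ i) : s (u + Pi.single i 1) j = s u j := by
    have h : (Pi.single (s u i) 1 + Pi.single (s (u + Pi.single i 1) j) 1 : ι → ℤ)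
        = Pi.single (s u j) 1 + Pi.single (s (u + Pi.single j 1) i) 1 := by
      refine add_left_cancel (a := θ u) ?_
      rw [← add_assoc, ← add_assoc, ← hs, ← hs, ← hs, ← hs, add_right_comm]
    by_contra hne
    have h1 := congrFun h (s u j)
    have h2 : s u j ≠ s u i := (hinj u).ne hij
    rw [Pi.add_apply, Pi.add_apply, Pi.single_eq_of_ne h2, Pi.single_eq_of_ne (Ne.symm hne),
      Pi.single_eq_same] at h1
    have h3 : (0 : ℤ) ≤ (Pi.single (s (u + Pi.single j 1) i) 1 : ι → ℤ) (s u j) := by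
      rw [Pi.single_apply]
      split_ifs <;> norm_num
    omega
  have hconst (u : ι → ℤ) : s u = s 0 := by
    refine eq_apply_zero_of_forall_add_single (F := s) (fun u i => ?_) u
    funext j
    rcases eq_or_ne j i with rfl | hj
    · obtain ⟨l, hl⟩ := (Finite.injective_iff_surjective.mp (hinj (u + Pi.single j 1))) (s u j)
      rcases eq_or_ne l j with rfl | hlj
      · exact hl
      · exact absurd (hinj u ((hoff u hlj).symm.trans hl)) hlj
    · exact hoff u hj
  let ρ : Equiv.Perm ι := Equiv.ofBijective (s 0) (Finite.injective_iff_bijective.mp (hinj 0))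
  refine ⟨ρ⁻¹, fun u => ?_⟩
  have h := eq_apply_zero_of_forall_add_single (F := fun u => θ u - u ∘ ρ.symm) (fun u i => ?_) u
  · have h0 : ((0 : ι → ℤ) ∘ ρ.symm) = 0 := rfl
    simp only [h0, sub_zero] at h
    rw [← h]
    exact (sub_add_cancel _ _).symm
  · have h1 : (u + Pi.single i 1) ∘ ρ.symm = u ∘ ρ.symm + Pi.single (ρ i) 1 := by
      funext j
      simp [Pi.single_apply, Equiv.symm_apply_eq]
    have h2 : ρ i = s u i := by rw [hconst u]; rfl
    simp only [h1, hs, h2]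
    abel

/-- Along the orbit of `0` under an order automorphism of an integer lattice of rank at least `2`
some nontrivial integral functional is bounded. -/
lemma OrderIso.exists_functional_bounded_orbit [Nontrivial ι] (θ : (ι → ℤ) ≃o (ι → ℤ)) :
    ∃ i j : ι, i ≠ j ∧ ∃ a b : ℤ, a ≠ 0 ∧ ∃ B : ℤ, ∀ m : ℕ,
      |a * θ^[m] 0 i + b * θ^[m] 0 j| ≤ B := by
  obtain ⟨σ, hσ⟩ := θ.exists_perm_of_int_pi
  have hiter (m : ℕ) (u : ι → ℤ) : θ^[m] u = θ^[m] 0 + u ∘ (σ ^ m : Equiv.Perm ι) := by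
    induction m with
    | zero => simp
    | succ m ih =>
      rw [iterate_succ_apply', iterate_succ_apply', ih, hσ, hσ (θ^[m] 0), pow_succ]
      funext i
      simp [add_assoc]
  set K := orderOf σ with hK
  have hKpos : 0 < K := orderOf_pos σ
  set v := θ^[K] 0 with hv
  have hper (m : ℕ) : θ^[m + K] 0 = v + θ^[m] 0 := by
    rw [add_comm, iterate_add_apply, hiter, hK, pow_orderOf_eq_one]
    rfl
  have hbound (i j : ι) (a b : ℤ) (hab : a * v i + b * v j = 0) :
      ∃ B : ℤ, ∀ m : ℕ, |a * θ^[m] 0 i + b * θ^[m] 0 j| ≤ B := by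
    let L : ℕ → ℤ := fun m => |a * θ^[m] 0 i + b * θ^[m] 0 j|
    have hL : Periodic L K := by
      intro m
      simp only [L, hper, Pi.add_apply]
      congr 1
      linear_combination hab
    refine ⟨∑ m ∈ Finset.range K, L m, fun m => ?_⟩
    change L m ≤ _
    rw [← hL.map_mod_nat m]
    exact Finset.single_le_sum (f := L) (fun _ _ => abs_nonneg _)
      (Finset.mem_range.mpr (Nat.mod_lt _ hKpos))
  obtain ⟨i, j, hij⟩ := exists_pair_ne ι
  by_cases hi : v i = 0
  · exact ⟨i, j, hij, 1, 0, one_ne_zero, hbound i j 1 0 (by rw [hi]; ring)⟩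
  · exact ⟨j, i, hij.symm, v i, -v j, hi, hbound j i _ _ (by ring)⟩

end IntegerLattice

open Solenoid

/-- A function on the solenoid, continuous away from `0`, that vanishes on the line shortly before
`0` and oscillates like the topologist's sine curve on the line immediately after `0`. -/
structure IsOscillating (f : solenoid → ℝ) : Prop where
  continuousAt : ∀ x, x ≠ 0 → ContinuousAt f x
  mem_Icc : ∀ x, f x ∈ Icc (-1 : ℝ) 1
  eq_zero_of_mem_Icc : ∀ s ∈ Icc (-1 : ℝ) 0, f (line s) = 0
  exists_eq : ∀ v ∈ Icc (-1 : ℝ) 1, ∀ ε > 0, ∃ s ∈ Ioo 0 ε, f (line s) = v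

lemma exists_isOscillating : ∃ f, IsOscillating f := by
  obtain ⟨f, h1, h2, h3, h4⟩ := exists_oscillating continuous_line line_injective
  rw [map_zero] at h1
  exact ⟨f, h1, h2, h3, h4⟩

/-- The graph of the family of all integer translates of `f` along the line, with a vertical
segment added over each integer point of the line. -/
def brokenGraph (f : solenoid → ℝ) : Set (solenoid × (ℤ → ℝ)) :=
  {p | (∀ k, p.2 k ∈ Icc (-1 : ℝ) 1) ∧ ∀ k : ℤ, p.1 ≠ line k → p.2 k = f (p.1 - line k)}

/-- The solenoid with each integer point of the line blown up to a segment, so that the line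
approaches this segment like the topologist's sine curve from the right. -/
def BrokenSolenoid (f : solenoid → ℝ) : Type := brokenGraph f

namespace BrokenSolenoid

variable {f : solenoid → ℝ}

instance : TopologicalSpace (BrokenSolenoid f) :=
  inferInstanceAs (TopologicalSpace (brokenGraph f))

instance : TopologicalSpace.MetrizableSpace (BrokenSolenoid f) :=
  IsEmbedding.subtypeVal.metrizableSpace

/-- The projection to the solenoid. -/
def base (p : BrokenSolenoid f) : solenoid := p.1.1

/-- The coordinate which oscillates near `line k`. -/
def height (p : BrokenSolenoid f) (k : ℤ) : ℝ := p.1.2 k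

lemma continuous_base : Continuous (base : BrokenSolenoid f → solenoid) :=
  continuous_fst.comp continuous_subtype_val

lemma continuous_height (k : ℤ) : Continuous fun p : BrokenSolenoid f => p.height k :=
  (continuous_apply k).comp (continuous_snd.comp continuous_subtype_val)

lemma height_mem (p : BrokenSolenoid f) (k : ℤ) : p.height k ∈ Icc (-1 : ℝ) 1 := p.2.1 k

lemma height_eq (p : BrokenSolenoid f) {k : ℤ} (h : p.base ≠ line k) :
    p.height k = f (p.base - line k) := p.2.2 k h

lemma ext_base_height {p q : BrokenSolenoid f} (hb : p.base = q.base)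
    (hh : ∀ k, p.height k = q.height k) : p = q :=
  Subtype.ext (Prod.ext hb (funext hh))

lemma eq_of_base_eq {p q : BrokenSolenoid f} (h : ∀ k : ℤ, p.base ≠ line k)
    (hb : p.base = q.base) : p = q :=
  ext_base_height hb fun k => by rw [height_eq p (h k), height_eq q (hb ▸ h k), hb]

lemma tendsto_iff {X : Type*} {l : Filter X} {g : X → BrokenSolenoid f} {p : BrokenSolenoid f} :
    Tendsto g l (𝓝 p) ↔ Tendsto (fun y => (g y).base) l (𝓝 p.base) ∧
      ∀ k, Tendsto (fun y => (g y).height k) l (𝓝 (p.height k)) := by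
  refine ⟨fun h => ⟨(continuous_base.tendsto p).comp h,
    fun k => ((continuous_height k).tendsto p).comp h⟩, fun ⟨h1, h2⟩ => ?_⟩
  exact tendsto_subtype_rng.mpr (h1.prodMk_nhds (tendsto_pi_nhds.mpr h2))

lemma continuousAt_iff {X : Type*} [TopologicalSpace X] {g : X → BrokenSolenoid f} {x : X} :
    ContinuousAt g x ↔ ContinuousAt (fun y => (g y).base) x ∧
      ∀ k, ContinuousAt (fun y => (g y).height k) x := tendsto_iff

lemma compactSpace (hf : IsOscillating f) : CompactSpace (BrokenSolenoid f) := by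
  refine isCompact_iff_compactSpace.mp ?_
  have hK : IsCompact ((univ : Set solenoid) ×ˢ
      (univ : Set ℤ).pi fun _ => Icc (-1 : ℝ) 1) :=
    isCompact_univ.prod (isCompact_univ_pi fun _ => isCompact_Icc)
  refine hK.of_isClosed_subset ?_ fun p hp => ⟨mem_univ _, fun k _ => hp.1 k⟩
  rw [brokenGraph, ofPred_and]
  refine IsClosed.inter ?_ ?_
  · rw [ofPred_forall]
    exact isClosed_iInter fun k => isClosed_Icc.preimage (by fun_prop)
  · rw [ofPred_forall]
    refine isClosed_iInter fun k => ?_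
    rw [← isOpen_compl_iff, isOpen_iff_eventually]
    intro p hp
    simp only [mem_compl_iff, mem_ofPred_eq, Classical.not_imp] at hp ⊢
    have hc : ContinuousAt (fun q : solenoid × (ℤ → ℝ) => f (q.1 - line k)) p :=
      (hf.continuousAt (p.1 - line k) (sub_ne_zero.mpr hp.1)).comp
        (f := fun q : solenoid × (ℤ → ℝ) => q.1 - line k)
        (continuous_fst.sub continuous_const).continuousAt
    have h2 : ContinuousAt (fun q : solenoid × (ℤ → ℝ) => q.2 k) p :=
      ((continuous_apply k).comp continuous_snd).continuousAt
    have h3 := (hc.tendsto.prodMk_nhds h2.tendsto).eventually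
      (isOpen_ne_fun continuous_fst continuous_snd |>.eventually_mem
        (show (f (p.1 - line k), p.2 k) ∈ {w : ℝ × ℝ | w.1 ≠ w.2} from Ne.symm hp.2))
    filter_upwards [continuous_fst.continuousAt.eventually_ne hp.1, h3] with q h4 h5
    exact ⟨h4, Ne.symm h5⟩

/-- The section of `base` given by the translates of `f`. -/
noncomputable def lift (hf : IsOscillating f) (x : solenoid) : BrokenSolenoid f :=
  ⟨(x, fun k => f (x - line k)), fun _ => hf.mem_Icc _, fun _ _ => rfl⟩

lemma base_lift (hf : IsOscillating f) (x : solenoid) : (lift hf x).base = x := rfl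

lemma height_lift (hf : IsOscillating f) (x : solenoid) (k : ℤ) :
    (lift hf x).height k = f (x - line k) := rfl

lemma continuousAt_translate (hf : IsOscillating f) {x y : solenoid} (h : x ≠ y) :
    ContinuousAt (fun z => f (z - y)) x :=
  (hf.continuousAt (x - y) (sub_ne_zero.mpr h)).comp (f := fun z => z - y)
    (continuous_id.sub continuous_const).continuousAt

lemma continuousAt_translate_line (hf : IsOscillating f) {s r : ℝ} (h : s ≠ r) :
    ContinuousAt (fun u => f (line u - line r)) s :=
  (continuousAt_translate hf (line_injective.ne h)).comp (f := line) continuous_line.continuousAt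

lemma continuousAt_lift (hf : IsOscillating f) {x : solenoid} (h : ∀ k : ℤ, x ≠ line k) :
    ContinuousAt (lift hf) x :=
  continuousAt_iff.mpr ⟨continuousAt_id, fun k => continuousAt_translate hf (h k)⟩

lemma line_ne_line_intCast {k : ℤ} {s : ℝ} (hs : s ∈ Ioo (k : ℝ) (k + 1)) (l : ℤ) :
    line s ≠ line l := by
  intro h
  rw [line_injective h] at hs
  have h1 : k < l := by exact_mod_cast hs.1
  have h2 : l < k + 1 := by exact_mod_cast hs.2
  omega

lemma exists_tendsto_lift (hf : IsOscillating f) {p : BrokenSolenoid f} {k : ℤ}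
    (hp : p.base = line k) :
    ∃ s : ℕ → ℝ, (∀ n, s n ∈ Ioo (k : ℝ) (k + 1)) ∧
      Tendsto (fun n => lift hf (line (s n))) atTop (𝓝 p) := by
  choose r hr hfr using fun n : ℕ =>
    hf.exists_eq (p.height k) (p.height_mem k) (1 / ((n : ℝ) + 1)) (by positivity)
  have hr1 (n : ℕ) : r n < 1 := by
    refine (hr n).2.trans_le ?_
    rw [div_le_one (by positivity)]
    linarith [(Nat.cast_nonneg n : (0 : ℝ) ≤ n)]
  have hr0 : Tendsto r atTop (𝓝 0) :=
    squeeze_zero (fun n => (hr n).1.le) (fun n => (hr n).2.le)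
      tendsto_one_div_add_atTop_nhds_zero_nat
  have hs : Tendsto (fun n => (k : ℝ) + r n) atTop (𝓝 k) := by
    simpa using hr0.const_add (k : ℝ)
  refine ⟨fun n => k + r n, fun n => ⟨by linarith [(hr n).1], by linarith [hr1 n]⟩, ?_⟩
  refine tendsto_iff.mpr ⟨?_, fun l => ?_⟩
  · rw [hp]
    exact (continuous_line.tendsto _).comp hs
  · simp only [height_lift]
    rcases eq_or_ne l k with rfl | hl
    · refine tendsto_const_nhds.congr fun n => ?_
      rw [map_add, add_sub_cancel_left, hfr]
    · have hkl : (k : ℝ) ≠ l := fun h => hl (by exact_mod_cast h.symm)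
      rw [height_eq p (hp ▸ line_injective.ne hkl), hp]
      exact (continuousAt_translate_line hf hkl).tendsto.comp hs

/-- The homeomorphism induced by translation by `line 1`. -/
noncomputable def shift (f : solenoid → ℝ) : BrokenSolenoid f ≃ₜ BrokenSolenoid f where
  toFun p := ⟨(p.base + line 1, fun k => p.height (k - 1)), fun _ => p.height_mem _, fun k hk => by
    have h : line k = line (k - 1 : ℤ) + line 1 := by rw [← map_add]; simp
    simp only [h] at hk ⊢
    rw [height_eq p fun h' => hk (by rw [h'])]
    congr 1
    abel⟩
  invFun p := ⟨(p.base - line 1, fun k => p.height (k + 1)), fun _ => p.height_mem _, fun k hk => by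
    have h : line (k + 1 : ℤ) = line k + line 1 := by rw [← map_add]; simp
    simp only at hk ⊢
    rw [height_eq p fun h' => hk (by rw [h', h, add_sub_cancel_right]), h]
    congr 1
    abel⟩
  left_inv p := ext_base_height (add_sub_cancel_right p.base (line 1)) fun k =>
    congrArg p.height (add_sub_cancel_right k 1)
  right_inv p := ext_base_height (sub_add_cancel p.base (line 1)) fun k =>
    congrArg p.height (sub_add_cancel k 1)
  continuous_toFun := continuous_iff_continuousAt.mpr fun p => continuousAt_iff.mpr
    ⟨(continuous_base.add continuous_const).continuousAt,
      fun k => (continuous_height (k - 1)).continuousAt⟩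
  continuous_invFun := continuous_iff_continuousAt.mpr fun p => continuousAt_iff.mpr
    ⟨(continuous_base.sub continuous_const).continuousAt,
      fun k => (continuous_height (k + 1)).continuousAt⟩

lemma base_shift (p : BrokenSolenoid f) : (shift f p).base = p.base + line 1 := rfl

lemma base_shift_iterate (p : BrokenSolenoid f) (n : ℕ) :
    ((shift f)^[n] p).base = p.base + line n := by
  induction n with
  | zero => simp
  | succ n ih =>
    rw [iterate_succ_apply', base_shift, ih, add_assoc, ← map_add, Nat.cast_succ]

lemma isMinimalMap_shift (hf : IsOscillating f) : IsMinimalMap (shift f) := by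
  refine ⟨(shift f).continuous, fun p => ?_⟩
  have := compactSpace hf
  set Z := closure (range fun n : ℕ => (shift f)^[n + 1] p) with hZ
  have hbase : base '' Z = univ := by
    refine eq_univ_of_forall fun x => ?_
    have hcl : IsClosed (base '' Z) := (isClosed_closure.isCompact.image continuous_base).isClosed
    refine hcl.closure_subset_iff.mpr ?_ (mem_closure_range_add_line p.base x)
    rintro _ ⟨j, rfl⟩
    refine ⟨(shift f)^[j + 1] p, subset_closure (mem_range_self j), ?_⟩
    rw [base_shift_iterate, Nat.cast_succ]
  have hfib : ∀ q : BrokenSolenoid f, (∀ k : ℤ, q.base ≠ line k) → q ∈ Z := by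
    intro q hq
    obtain ⟨z, hz, hzq⟩ := hbase.symm ▸ mem_univ q.base
    rwa [eq_of_base_eq hq hzq.symm]
  intro q
  by_cases hq : ∀ k : ℤ, q.base ≠ line k
  · exact hfib q hq
  · push Not at hq
    obtain ⟨k, hk⟩ := hq
    obtain ⟨s, hs, hlim⟩ := exists_tendsto_lift hf hk
    exact isClosed_closure.mem_of_tendsto hlim
      (Eventually.of_forall fun n => hfib _ (line_ne_line_intCast (hs n)))

lemma add_line_ne_line {x : solenoid} (hx : x ∉ range line) (s r : ℝ) :
    x + line s ≠ line r := fun h => hx ⟨r - s, by rw [map_sub, ← h, add_sub_cancel_right]⟩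

lemma continuous_lift_add_line (hf : IsOscillating f) {x : solenoid} (hx : x ∉ range line) :
    Continuous fun s => lift hf (x + line s) :=
  continuous_iff_continuousAt.mpr fun s =>
    (continuousAt_lift hf fun k => add_line_ne_line hx s k).comp (f := fun s => x + line s)
      (continuous_const.add continuous_line).continuousAt

lemma dense_range_lift_add_line (hf : IsOscillating f) {x : solenoid} (hx : x ∉ range line) :
    Dense (range fun s => lift hf (x + line s)) := by
  refine ((isMinimalMap_shift hf).2 (lift hf x)).mono ?_
  rintro _ ⟨n, rfl⟩
  refine ⟨(n + 1 : ℕ), ?_⟩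
  refine eq_of_base_eq (fun k => add_line_ne_line hx _ k) ?_
  rw [base_shift_iterate, base_lift, base_lift]

lemma connectedSpace (hf : IsOscillating f) : ConnectedSpace (BrokenSolenoid f) := by
  obtain ⟨x, hx⟩ := exists_notMem_range_line
  have h := (isConnected_range (continuous_lift_add_line hf hx)).closure
  rw [(dense_range_lift_add_line hf hx).closure_eq] at h
  exact connectedSpace_iff_univ.mpr h

lemma joined_of_base_eq {p q : BrokenSolenoid f} (h : p.base = q.base) : Joined p q := by
  let g : unitInterval → BrokenSolenoid f := fun τ =>
    ⟨(p.base, fun k => (1 - (τ : ℝ)) * p.height k + τ * q.height k), fun k => by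
      exact (convex_Icc (-1 : ℝ) 1) (p.height_mem k) (q.height_mem k)
        (sub_nonneg.mpr τ.2.2) τ.2.1 (by ring), fun k hk => by
      simp only at hk ⊢
      rw [height_eq p hk, height_eq q (h ▸ hk), ← h]
      ring⟩
  have hg : Continuous g := by
    refine continuous_iff_continuousAt.mpr fun τ => continuousAt_iff.mpr
      ⟨continuousAt_const, fun k => ?_⟩
    exact Continuous.continuousAt
      (f := fun τ : unitInterval => (1 - (τ : ℝ)) * p.height k + τ * q.height k) (by fun_prop)
  refine ⟨⟨⟨g, hg⟩, ?_, ?_⟩⟩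
  · exact ext_base_height rfl fun k => by simp [g, height]
  · exact ext_base_height h fun k => by simp [g, height]

/-- The points lying over the arc of the line from `k - 1` (exclusive) to `k` (inclusive). -/
def HasLevel (p : BrokenSolenoid f) (k : ℤ) : Prop := ∃ s, p.base = line s ∧ ⌈s⌉ = k

lemma HasLevel.unique {p : BrokenSolenoid f} {k l : ℤ} (hk : p.HasLevel k) (hl : p.HasLevel l) :
    k = l := by
  obtain ⟨s, hs, rfl⟩ := hk
  obtain ⟨r, hr, rfl⟩ := hl
  rw [line_injective (hs.symm.trans hr)]

lemma hasLevel_lift (hf : IsOscillating f) (k : ℤ) : (lift hf (line k)).HasLevel k :=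
  ⟨k, rfl, Int.ceil_intCast k⟩

lemma continuousOn_lift_line (hf : IsOscillating f) (k : ℤ) :
    ContinuousOn (fun s => lift hf (line s)) (Ioc ((k : ℝ) - 1) k) := by
  intro s hs
  refine tendsto_iff.mpr ⟨continuous_line.continuousWithinAt, fun l => ?_⟩
  simp only [height_lift]
  by_cases hsl : s = l
  · have hl : l = k := by
      rw [hsl] at hs
      have h1 : k - 1 < l := by exact_mod_cast hs.1
      have h2 : l ≤ k := by exact_mod_cast hs.2
      omega
    have hzero : ∀ u ∈ Ioc ((k : ℝ) - 1) k, f (line u - line l) = 0 := by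
      intro u hu
      rw [← map_sub, hl]
      exact hf.eq_zero_of_mem_Icc _ ⟨by linarith [hu.1], by linarith [hu.2]⟩
    rw [hzero s hs]
    exact tendsto_const_nhds.congr' (eventually_mem_nhdsWithin.mono fun u hu => (hzero u hu).symm)
  · exact (continuousAt_translate_line hf hsl).continuousWithinAt

lemma HasLevel.joined (hf : IsOscillating f) {p q : BrokenSolenoid f} {k : ℤ}
    (hp : p.HasLevel k) (hq : q.HasLevel k) : Joined p q := by
  obtain ⟨s, hs, hsk⟩ := hp
  obtain ⟨r, hr, hrk⟩ := hq
  rw [Int.ceil_eq_iff] at hsk hrk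
  have hpc : IsPathConnected (Ioc ((k : ℝ) - 1) k) :=
    (convex_Ioc _ _).isPathConnected ⟨s, hsk⟩
  have hj := ((hpc.image' (continuousOn_lift_line hf k)).joinedIn _ (mem_image_of_mem _ hsk) _
    (mem_image_of_mem _ hrk)).joined
  exact (joined_of_base_eq (by rw [hs]; rfl)).trans
    (hj.trans (joined_of_base_eq (by rw [hr]; rfl)))

lemma isClopen_setOf_le (hf : IsOscillating f) (γ : C(unitInterval, BrokenSolenoid f))
    {S : unitInterval → ℝ} (hSc : Continuous S) (hS : ∀ τ, (γ τ).base = line (S τ)) (k : ℤ) :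
    IsClopen {τ | S τ ≤ k} := by
  refine ⟨isClosed_le hSc continuous_const, isOpen_iff_mem_nhds.mpr fun τ₀ hτ₀ => ?_⟩
  rcases lt_or_eq_of_le (show S τ₀ ≤ k from hτ₀) with hlt | heq
  · filter_upwards [hSc.continuousAt.eventually_lt_const hlt] with τ hτ using hτ.le
  · have hc : Continuous fun τ => (γ τ).height k := (continuous_height k).comp γ.continuous
    let V : Set unitInterval := {τ | |(γ τ).height k - (γ τ₀).height k| < 1 / 2}
    have hV : V ∈ 𝓝 τ₀ :=
      (isOpen_lt (by fun_prop) continuous_const).mem_nhds (by simp)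
    obtain ⟨a, b, hab, hnhds, hIV⟩ := exists_Icc_mem_subset_of_mem_nhds hV
    filter_upwards [hnhds] with τ₁ hτ₁
    by_contra hle
    have hlt : k < S τ₁ := not_le.mp hle
    have hsub := (isPreconnected_Icc.image S hSc.continuousOn).Icc_subset
      (mem_image_of_mem S hab) (mem_image_of_mem S hτ₁)
    have hval : ∀ v ∈ Icc (-1 : ℝ) 1, |v - (γ τ₀).height k| < 1 / 2 := by
      intro v hv
      obtain ⟨r, hr, rfl⟩ := hf.exists_eq v hv (S τ₁ - k) (sub_pos.mpr hlt)
      obtain ⟨τ, hτ, hSτ⟩ := hsub (show k + r ∈ Icc (S τ₀) (S τ₁) from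
        ⟨by linarith [hr.1], by linarith [hr.2]⟩)
      have hτV : |(γ τ).height k - (γ τ₀).height k| < 1 / 2 := hIV hτ
      rwa [height_eq, hS, hSτ, ← map_sub, add_sub_cancel_left] at hτV
      rw [hS, hSτ]
      exact line_injective.ne (by linarith [hr.1])
    have h1 := abs_lt.mp (hval 1 (by norm_num))
    have h2 := abs_lt.mp (hval (-1) (by norm_num))
    linarith [h1.2, h2.1]

lemma HasLevel.of_joined (hf : IsOscillating f) {p q : BrokenSolenoid f} {k : ℤ}
    (hp : p.HasLevel k) (h : Joined p q) : q.HasLevel k := by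
  obtain ⟨s, hs, rfl⟩ := hp
  obtain ⟨γ⟩ := h
  obtain ⟨σ, hσ0, hσ⟩ := exists_lift_path
    ⟨fun τ => (γ τ).base, continuous_base.comp γ.continuous⟩
  simp only [ContinuousMap.coe_mk, γ.source, hs, ← map_add] at hσ
  refine ⟨s + σ 1, by rw [← hσ, γ.target], ?_⟩
  refine eq_of_forall_ge_iff fun k => ?_
  rw [Int.ceil_le, Int.ceil_le]
  have hclopen := isClopen_setOf_le hf γ.toContinuousMap (S := fun τ => s + σ τ) (by fun_prop)
    hσ k
  have h0 : s ≤ k ↔ (0 : unitInterval) ∈ {τ : unitInterval | s + σ τ ≤ k} := by simp [hσ0]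
  rw [h0]
  rcases isClopen_iff.mp hclopen with he | he
  · rw [he]
    exact iff_of_false (fun h => (he ▸ h : (1 : unitInterval) ∈ (∅ : Set _))) id
  · rw [he]
    exact iff_of_true (show (1 : unitInterval) ∈ {τ | s + σ τ ≤ k} from he ▸ mem_univ _)
      (mem_univ _)

lemma HasLevel.reaches_iff (hf : IsOscillating f) {p q : BrokenSolenoid f} {k : ℤ}
    (hp : p.HasLevel k) : Reaches p q ↔ q.HasLevel k ∨ q.HasLevel (k - 1) := by
  constructor
  · rintro ⟨z, hz, hqz⟩
    have hcl : IsClosed (base ⁻¹' (line '' Icc ((k : ℝ) - 1) k) : Set (BrokenSolenoid f)) :=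
      (isCompact_Icc.image continuous_line).isClosed.preimage continuous_base
    have hsub : pathComponent p ⊆ base ⁻¹' (line '' Icc ((k : ℝ) - 1) k) := by
      intro x hx
      obtain ⟨r, hr, hrk⟩ := hp.of_joined hf hx
      rw [Int.ceil_eq_iff] at hrk
      exact ⟨r, ⟨hrk.1.le, hrk.2⟩, hr.symm⟩
    obtain ⟨r, hr, hrz⟩ := hcl.closure_subset_iff.mpr hsub hz
    have hj : Joined z q := Joined.symm hqz
    rcases eq_or_lt_of_le hr.1 with h | h
    · refine Or.inr (HasLevel.of_joined hf ⟨r, hrz.symm, ?_⟩ hj)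
      rw [← h]
      exact_mod_cast Int.ceil_intCast (k - 1)
    · exact Or.inl (HasLevel.of_joined hf ⟨r, hrz.symm, Int.ceil_eq_iff.mpr ⟨h, hr.2⟩⟩ hj)
  · rintro (hq | hq)
    · exact ⟨q, subset_closure (hp.joined hf hq), mem_pathComponent_self q⟩
    · obtain ⟨s, hs, hlim⟩ :=
        exists_tendsto_lift hf (base_lift hf (line (k - 1 : ℤ)))
      refine ⟨_, mem_closure_of_tendsto hlim (Eventually.of_forall fun n => ?_),
        hq.joined hf (hasLevel_lift hf (k - 1))⟩
      refine hp.joined hf ⟨s n, rfl, Int.ceil_eq_iff.mpr ?_⟩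
      have := hs n
      push_cast at this
      exact ⟨this.1, by linarith [this.2]⟩

lemma reaches_of_notMem_range_line (hf : IsOscillating f) {p : BrokenSolenoid f}
    (hp : p.base ∉ range line) (q : BrokenSolenoid f) : Reaches p q := by
  have hsub : range (fun s => lift hf (p.base + line s)) ⊆ pathComponent p := by
    have hpc := isPathConnected_range (continuous_lift_add_line hf hp)
    rintro x hx
    have h0 : Joined p (lift hf (p.base + line 0)) :=
      joined_of_base_eq (by rw [base_lift, map_zero, add_zero])
    exact h0.trans (hpc.joinedIn _ (mem_range_self 0) _ hx).joined
  exact ⟨q, (dense_range_lift_add_line hf hp).mono hsub q, mem_pathComponent_self q⟩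

lemma exists_hasLevel_or_forall_reaches (hf : IsOscillating f) (p : BrokenSolenoid f) :
    (∃ k, p.HasLevel k) ∨ ∀ q, Reaches p q := by
  by_cases h : p.base ∈ range line
  · obtain ⟨s, hs⟩ := h
    exact Or.inl ⟨⌈s⌉, s, hs.symm, rfl⟩
  · exact Or.inr (reaches_of_notMem_range_line hf h)

section Power

variable {ι : Type*}

/-- Each coordinate of `p` has the level given by the corresponding entry of `u`. -/
def HasLevels (p : ι → BrokenSolenoid f) (u : ι → ℤ) : Prop := ∀ i, (p i).HasLevel (u i)

/-- The point of the power whose coordinates are the lifts of the integer points `u i`. -/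
noncomputable def latticePoint (hf : IsOscillating f) (u : ι → ℤ) : ι → BrokenSolenoid f :=
  fun i => lift hf (line (u i))

lemma hasLevels_latticePoint (hf : IsOscillating f) (u : ι → ℤ) :
    HasLevels (latticePoint hf u) u := fun i => hasLevel_lift hf (u i)

lemma HasLevels.unique {p : ι → BrokenSolenoid f} {u v : ι → ℤ} (hu : HasLevels p u)
    (hv : HasLevels p v) : u = v := funext fun i => (hu i).unique (hv i)

lemma HasLevels.joined (hf : IsOscillating f) {p q : ι → BrokenSolenoid f} {u : ι → ℤ}
    (hp : HasLevels p u) (hq : HasLevels q u) : Joined p q :=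
  joined_pi_iff.mpr fun i => (hp i).joined hf (hq i)

lemma HasLevels.of_joined (hf : IsOscillating f) {p q : ι → BrokenSolenoid f} {u : ι → ℤ}
    (hp : HasLevels p u) (h : Joined p q) : HasLevels q u :=
  fun i => (hp i).of_joined hf (joined_pi_iff.mp h i)

lemma HasLevels.reaches_iff (hf : IsOscillating f) {p q : ι → BrokenSolenoid f} {u : ι → ℤ}
    (hp : HasLevels p u) : Reaches p q ↔ ∃ v, HasLevels q v ∧ CubeStep u v := by
  rw [reaches_pi_iff]
  constructor
  · intro h
    have (i : ι) : ∃ l, (q i).HasLevel l ∧ (l = u i ∨ l = u i - 1) := by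
      rcases ((hp i).reaches_iff hf).mp (h i) with h1 | h1
      exacts [⟨_, h1, Or.inl rfl⟩, ⟨_, h1, Or.inr rfl⟩]
    choose v hv using this
    exact ⟨v, fun i => (hv i).1, fun i => (hv i).2⟩
  · rintro ⟨v, hv, huv⟩ i
    rw [(hp i).reaches_iff hf]
    rcases huv i with h | h
    · exact Or.inl (h ▸ hv i)
    · exact Or.inr (h ▸ hv i)

lemma HasLevels.reaches_iff_cubeStep (hf : IsOscillating f) {p q : ι → BrokenSolenoid f}
    {u v : ι → ℤ} (hp : HasLevels p u) (hq : HasLevels q v) : Reaches p q ↔ CubeStep u v := by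
  rw [hp.reaches_iff hf]
  exact ⟨fun ⟨w, hw, huw⟩ => hq.unique hw ▸ huw, fun h => ⟨v, hq, h⟩⟩

lemma HasLevels.finitelyReaching [Finite ι] (hf : IsOscillating f) {p : ι → BrokenSolenoid f}
    {u : ι → ℤ} (hp : HasLevels p u) : FinitelyReaching p := by
  refine ⟨latticePoint hf '' univ.pi fun i => {u i, u i - 1},
    (Finite.pi fun i => toFinite _).image _, fun q hq => ?_⟩
  obtain ⟨v, hv, huv⟩ := (hp.reaches_iff hf).mp hq
  exact ⟨_, mem_image_of_mem _ fun i _ => huv i, (hasLevels_latticePoint hf v).joined hf hv⟩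

lemma _root_.FinitelyReaching.exists_hasLevels (hf : IsOscillating f)
    {p : ι → BrokenSolenoid f} (hp : FinitelyReaching p) : ∃ u, HasLevels p u := by
  classical
  obtain ⟨F, hF, hpF⟩ := hp
  have (i : ι) : ∃ k, (p i).HasLevel k := by
    refine (exists_hasLevel_or_forall_reaches hf (p i)).resolve_right fun hi => ?_
    let q (k : ℤ) : ι → BrokenSolenoid f := update p i (lift hf (line k))
    have hq (k : ℤ) : Reaches p (q k) := by
      refine reaches_pi_iff.mpr fun j => ?_
      rcases eq_or_ne j i with rfl | hj
      · exact hi _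
      · rw [show q k j = p j from update_of_ne hj _ _]
        exact ⟨p j, subset_closure (mem_pathComponent_self _), mem_pathComponent_self _⟩
    choose z hz hzq using fun k => hpF (q k) (hq k)
    have hlev (k : ℤ) : (z k i).HasLevel k := by
      refine HasLevel.of_joined hf (hasLevel_lift hf k) ?_
      simpa [q] using (joined_pi_iff.mp (hzq k) i).symm
    exact infinite_of_injective_forall_mem
      (fun k l (hkl : z k = z l) => (hlev k).unique (hkl ▸ hlev l)) hz hF
  choose u hu using this
  exact ⟨u, hu⟩

lemma exists_forall_hasLevels_apply [Finite ι] (hf : IsOscillating f)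
    (h : (ι → BrokenSolenoid f) ≃ₜ (ι → BrokenSolenoid f)) :
    ∃ θ : (ι → ℤ) → ι → ℤ, ∀ p u, HasLevels p u → HasLevels (h p) (θ u) := by
  choose θ hθ using fun u : ι → ℤ =>
    (((hasLevels_latticePoint hf u).finitelyReaching hf).map h).exists_hasLevels hf
  exact ⟨θ, fun p u hp => (hθ u).of_joined hf
    (((hasLevels_latticePoint hf u).joined hf hp).map h.continuous)⟩

lemma exists_orderIso_forall_hasLevels_apply [Fintype ι] (hf : IsOscillating f)
    (h : (ι → BrokenSolenoid f) ≃ₜ (ι → BrokenSolenoid f)) :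
    ∃ θ : (ι → ℤ) ≃o (ι → ℤ), ∀ p u, HasLevels p u → HasLevels (h p) (θ u) := by
  obtain ⟨θ, hθ⟩ := exists_forall_hasLevels_apply hf h
  obtain ⟨η, hη⟩ := exists_forall_hasLevels_apply hf h.symm
  have hleft (u : ι → ℤ) : η (θ u) = u := by
    have hu := hasLevels_latticePoint hf u
    refine HasLevels.unique ?_ hu
    simpa using hη _ _ (hθ _ _ hu)
  have hright (u : ι → ℤ) : θ (η u) = u := by
    have hu := hasLevels_latticePoint hf u
    refine HasLevels.unique ?_ hu
    simpa using hθ _ _ (hη _ _ hu)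
  have hstep (u v : ι → ℤ) (huv : CubeStep u v) : CubeStep (θ u) (θ v) := by
    have hu := hasLevels_latticePoint hf u
    have hv := hasLevels_latticePoint hf v
    rwa [← (hθ _ _ hu).reaches_iff_cubeStep hf (hθ _ _ hv), h.reaches_iff,
      hu.reaches_iff_cubeStep hf hv]
  have hstep' (u v : ι → ℤ) (huv : CubeStep u v) : CubeStep (η u) (η v) := by
    have hu := hasLevels_latticePoint hf u
    have hv := hasLevels_latticePoint hf v
    rwa [← (hη _ _ hu).reaches_iff_cubeStep hf (hη _ _ hv), h.symm.reaches_iff,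
      hu.reaches_iff_cubeStep hf hv]
  refine ⟨⟨⟨θ, η, hleft, hright⟩, fun {u v} => ?_⟩, hθ⟩
  rw [Equiv.coe_fn_mk, ← reflTransGen_cubeStep_iff, ← reflTransGen_cubeStep_iff]
  refine ⟨fun huv => ?_, fun huv => huv.lift θ hstep⟩
  have := huv.lift η hstep'
  rwa [onFun_apply, hleft, hleft] at this

lemma norm_zsmul_add_zsmul_line_le (a b : ℤ) (s r : ℝ) (N : ℕ) :
    ‖a • (line s).1 N + b • (line r).1 N‖ ≤ √2 * |a * s + b * r| / 2 ^ N := by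
  have h : a • (line s).1 N + b • (line r).1 N
      = ((√2 * (a * s + b * r) / 2 ^ N : ℝ) : UnitAddCircle) := by
    rw [line_apply, line_apply, ← AddCircle.coe_zsmul, ← AddCircle.coe_zsmul, ← AddCircle.coe_add]
    congr 1
    simp only [zsmul_eq_mul]
    ring
  rw [h]
  refine (QuotientAddGroup.norm_mk_le_norm).trans_eq ?_
  rw [Real.norm_eq_abs, abs_div, abs_mul, abs_of_nonneg (Real.sqrt_nonneg 2),
    abs_of_pos (by positivity : (0 : ℝ) < 2 ^ N)]

theorem not_admitsMinimalHomeo_pi [Finite ι] [Nontrivial ι] (hf : IsOscillating f) :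
    ¬ AdmitsMinimalHomeo (ι → BrokenSolenoid f) := by
  classical
  have := Fintype.ofFinite ι
  rintro ⟨h, -, hmin⟩
  obtain ⟨θ, hθ⟩ := exists_orderIso_forall_hasLevels_apply hf h
  obtain ⟨i, j, hij, a, b, ha, B, hB⟩ := θ.exists_functional_bounded_orbit
  have hlev (m : ℕ) : HasLevels (h^[m] (latticePoint hf 0)) (θ^[m] 0) := by
    induction m with
    | zero => exact hasLevels_latticePoint hf 0
    | succ m ih =>
      rw [iterate_succ_apply', iterate_succ_apply']
      exact hθ _ _ ih
  obtain ⟨N, hN⟩ := pow_unbounded_of_one_lt (8 * (√2 * (B + |(a : ℝ)| + |(b : ℝ)|))) one_lt_two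
  let g (y : ι → BrokenSolenoid f) : ℝ := ‖a • (y i).base.1 N + b • (y j).base.1 N‖
  have hg : Continuous g := by
    have hc (l : ι) : Continuous fun y : ι → BrokenSolenoid f => (y l).base.1 N :=
      (continuous_apply N).comp
        (continuous_subtype_val.comp (continuous_base.comp (continuous_apply l)))
    exact (((hc i).zsmul a).add ((hc j).zsmul b)).norm
  have horbit (m : ℕ) : g (h^[m] (latticePoint hf 0)) ≤ 1 / 8 := by
    obtain ⟨s, hs, hsi⟩ := hlev m i
    obtain ⟨r, hr, hrj⟩ := hlev m j
    have hceil (t : ℝ) : |t - ⌈t⌉| ≤ 1 := by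
      rw [abs_le]
      constructor <;> linarith [Int.le_ceil t, Int.ceil_lt_add_one t]
    have hsum : |a * s + b * r| ≤ B + |(a : ℝ)| + |(b : ℝ)| := by
      have hB' : |(a : ℝ) * ⌈s⌉ + b * ⌈r⌉| ≤ B := by
        have := hB m
        rw [← hsi, ← hrj] at this
        exact_mod_cast this
      calc |a * s + b * r|
          = |(a * ⌈s⌉ + b * ⌈r⌉) + a * (s - ⌈s⌉) + b * (r - ⌈r⌉)| := by congr 1; ring
        _ ≤ |(a : ℝ) * ⌈s⌉ + b * ⌈r⌉| + |a * (s - ⌈s⌉)| + |b * (r - ⌈r⌉)| := abs_add_three _ _ _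
        _ ≤ B + |(a : ℝ)| + |(b : ℝ)| := by
          rw [abs_mul, abs_mul]
          gcongr
          · exact mul_le_of_le_one_right (abs_nonneg _) (hceil s)
          · exact mul_le_of_le_one_right (abs_nonneg _) (hceil r)
    simp only [g, hs, hr]
    refine (norm_zsmul_add_zsmul_line_le a b s r N).trans ?_
    rw [div_le_iff₀ (by positivity)]
    have := mul_le_mul_of_nonneg_left hsum (Real.sqrt_nonneg 2)
    linarith
  have hall (y : ι → BrokenSolenoid f) : g y ≤ 1 / 8 := by
    have hcl : IsClosed {y | g y ≤ 1 / 8} := isClosed_le hg continuous_const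
    refine hcl.closure_subset_iff.mpr ?_ (hmin (latticePoint hf 0) y)
    rintro _ ⟨m, rfl⟩
    exact horbit (m + 1)
  have ha' : (a : ℝ) ≠ 0 := by exact_mod_cast ha
  have hlast := hall (update (latticePoint hf 0) i (lift hf (line (2 ^ N / (2 * √2 * a)))))
  have hval : a • (line (2 ^ N / (2 * √2 * a))).1 N = ((1 / 2 : ℝ) : UnitAddCircle) := by
    rw [line_apply, ← AddCircle.coe_zsmul]
    congr 1
    rw [zsmul_eq_mul]
    field_simp
  have hzero : (line ((0 : ℤ) : ℝ)).1 N = 0 := by simp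
  simp only [g, update_self, update_of_ne hij.symm, latticePoint, base_lift, hval, Pi.zero_apply,
    hzero, smul_zero, add_zero] at hlast
  have hhalf : ‖((1 / 2 : ℝ) : UnitAddCircle)‖ = 1 / 2 := by
    rw [UnitAddCircle.norm_eq]
    norm_num [round_eq]
  rw [hhalf] at hlast
  norm_num at hlast

end Power

end BrokenSolenoid

/-- There exists a compact connected metrizable space `Y` admitting a minimal
homeomorphism such that no finite Cartesian power `Y^n`, `n ≥ 2`, admits one. -/
theorem stmt1 :
    ∃ (Y : Type) (_ : TopologicalSpace Y),
      CompactSpace Y ∧ ConnectedSpace Y ∧ TopologicalSpace.MetrizableSpace Y ∧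
      AdmitsMinimalHomeo Y ∧ ∀ n : ℕ, 2 ≤ n → ¬ AdmitsMinimalHomeo (Fin n → Y) := by
  obtain ⟨f, hf⟩ := exists_isOscillating
  refine ⟨BrokenSolenoid f, inferInstance, BrokenSolenoid.compactSpace hf,
    BrokenSolenoid.connectedSpace hf, inferInstance,
    ⟨BrokenSolenoid.shift f, BrokenSolenoid.isMinimalMap_shift hf⟩, fun n hn => ?_⟩
  have : Nontrivial (Fin n) := Fin.nontrivial_iff_two_le.mpr hn
  exact BrokenSolenoid.not_admitsMinimalHomeo_pi hf
end
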